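/- arXiv:1511.07697 — 4 statements merged into one kernel-verified Lean document; each statement's English description precedes it below -/
import Mathlib

section
/- Let w ∈ W and let I ⊆ Π be such that wμ ∈ μ − ℝ₊I. Then there exists u ∈ W_I such that wμ = uμ. -/
open Set Module

noncomputable section

/-- The linear reflection `x ↦ x - f x • a` associated to a vector `a` and a linear
functional `f` with `f a = 2`, bundled as a linear automorphism. -/
def reflEquiv {V : Type*} [AddCommGroup V] [Module ℝ V]
    (a : V) (f : V →ₗ[ℝ] ℝ) (h2 : f a = 2) : V ≃ₗ[ℝ] V :=
  LinearEquiv.ofInvolutive (LinearMap.id - f.smulRight a)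
    (fun x => by
      simp only [LinearMap.sub_apply, LinearMap.id_apply, LinearMap.smulRight_apply,
        map_sub, map_smul, smul_eq_mul, h2]
      module)

/-- A realization over `ℝ` of an `m × m` generalized Cartan matrix `A`:
simple roots `α_i`, simple coroots `α_i∨` (as linear functionals), with
`⟨α_j, α_i∨⟩ = a_{ij}`, together with the defining axioms. -/
structure GCMRealization (m : ℕ) (V : Type*) [NormedAddCommGroup V] [NormedSpace ℝ V] where
  A : Matrix (Fin m) (Fin m) ℤ
  root : Fin m → V
  coroot : Fin m → V →ₗ[ℝ] ℝ
  one_le_m : 1 ≤ m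
  A_diag : ∀ i, A i i = 2
  A_offdiag : ∀ i j, i ≠ j → A i j ≤ 0
  A_zero_iff : ∀ i j, A i j = 0 ↔ A j i = 0
  root_indep : LinearIndependent ℝ root
  coroot_indep : LinearIndependent ℝ coroot
  pairing : ∀ i j, coroot i (root j) = (A i j : ℝ)
  finDim : FiniteDimensional ℝ V
  dim_eq : finrank ℝ V + (A.map ((↑) : ℤ → ℝ)).rank = 2 * m

/-- A face of a convex set `H`: a convex subset `F ⊆ H` such that whenever the open
segment between two points of `H` meets `F`, both points lie in `F`. -/
def IsFaceOf {V : Type*} [NormedAddCommGroup V] [NormedSpace ℝ V] (H F : Set V) : Prop :=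
  Convex ℝ F ∧ IsExtreme ℝ H F

namespace GCMRealization

variable {m : ℕ} {V : Type*} [NormedAddCommGroup V] [NormedSpace ℝ V]
variable (S : GCMRealization m V)

/-- The fundamental reflection `r_i`. -/
def s (i : Fin m) : V ≃ₗ[ℝ] V :=
  reflEquiv (S.root i) (S.coroot i) (by
    have h := S.pairing i i
    rw [S.A_diag i] at h
    simpa using h)

/-- The Weyl group `W`, as a subgroup of the group of linear automorphisms of `V`. -/
def W : Subgroup (V ≃ₗ[ℝ] V) := Subgroup.closure (Set.range S.s)

/-- The standard parabolic subgroup `W_I` generated by the reflections indexed by `I`. -/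
def WI (I : Set (Fin m)) : Subgroup (V ≃ₗ[ℝ] V) := Subgroup.closure (S.s '' I)

/-- The closed fundamental chamber `C̄`. -/
def chamber : Set V := {η | ∀ i, 0 ≤ S.coroot i η}

/-- `J₀`: the set of indices `i` with `⟨μ, α_i∨⟩ = 0`. -/
def J0 (μ : V) : Set (Fin m) := {i | S.coroot i μ = 0}

/-- The orbit of `μ` under a subgroup of linear automorphisms. -/
def orbitOf (G : Subgroup (V ≃ₗ[ℝ] V)) (μ : V) : Set V :=
  (fun w : V ≃ₗ[ℝ] V => w μ) '' (G : Set (V ≃ₗ[ℝ] V))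

/-- `F_I`: the convex hull of `W_I · μ`. -/
def face (μ : V) (I : Set (Fin m)) : Set V := convexHull ℝ (orbitOf (S.WI I) μ)

/-- `H`: the convex hull of the Weyl group orbit of `μ`. -/
def orbitHull (μ : V) : Set V := convexHull ℝ (orbitOf S.W μ)

/-- `ℝ₊I`: the set of nonnegative linear combinations of the simple roots indexed by `I`. -/
def coneNonneg (I : Set (Fin m)) : Set V :=
  {v | ∃ c : Fin m → ℝ, (∀ i, 0 ≤ c i) ∧ (∀ i, i ∉ I → c i = 0) ∧ v = ∑ i, c i • S.root i}

/-- `ℝ_>I`: the set of strictly positive linear combinations of the simple roots indexed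
by `I` (with `ℝ_>∅ = {0}`). -/
def conePos (I : Set (Fin m)) : Set V :=
  {v | ∃ c : Fin m → ℝ, (∀ i ∈ I, 0 < c i) ∧ (∀ i, i ∉ I → c i = 0) ∧ v = ∑ i, c i • S.root i}

/-- The open standard facet `C_J`. -/
def openFacet (J : Set (Fin m)) : Set V :=
  {η | (∀ i ∈ J, S.coroot i η = 0) ∧ ∀ i, i ∉ J → 0 < S.coroot i η}

/-- The closed standard facet `C̄_J`. -/
def closedFacet (J : Set (Fin m)) : Set V :=
  {η | (∀ i ∈ J, S.coroot i η = 0) ∧ ∀ i, i ∉ J → 0 ≤ S.coroot i η}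

/-- Adjacency of two vertices of the Dynkin diagram: `i ≠ j` and `a_{ij} ≠ 0`
(equivalently `a_{ji} ≠ 0`). -/
def Adjacent (i j : Fin m) : Prop := i ≠ j ∧ S.A i j ≠ 0 ∧ S.A j i ≠ 0

/-- The Dynkin diagram, as a simple graph on the index set. -/
def diagram : SimpleGraph (Fin m) where
  Adj := S.Adjacent
  symm := ⟨fun _ _ h => ⟨h.1.symm, h.2.2, h.2.1⟩⟩
  loopless := ⟨fun _ h => h.1 rfl⟩

/-- A subset `I` is `μ`-connected if every connected component of `I` meets
`J_> = Π \ J₀` (the empty set is `μ`-connected). -/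
def MuConnected (μ : V) (I : Set (Fin m)) : Prop :=
  ∀ i : I, ∃ j : I, S.coroot (j : Fin m) μ ≠ 0 ∧ (S.diagram.induce I).Reachable i j

/-- The connected component of `i` inside `K`, as a subset of the index set. -/
def comp (K : Set (Fin m)) (i : Fin m) : Set (Fin m) :=
  {j | ∃ (hi : i ∈ K) (hj : j ∈ K), (S.diagram.induce K).Reachable ⟨i, hi⟩ ⟨j, hj⟩}

/-- `I*`: the largest `μ`-connected subset of `I`, i.e. the union of the connected
components of `I` that meet `J_>`. -/
def muPart (μ : V) (I : Set (Fin m)) : Set (Fin m) :=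
  {j | ∃ (hj : j ∈ I) (k : Fin m) (hk : k ∈ I), S.coroot k μ ≠ 0 ∧
    (S.diagram.induce I).Reachable ⟨j, hj⟩ ⟨k, hk⟩}

/-- `I_*`: the set of `α ∈ J₀ \ I` orthogonal to all of `I`. -/
def starSet (μ : V) (I : Set (Fin m)) : Set (Fin m) :=
  {i | S.coroot i μ = 0 ∧ i ∉ I ∧ ∀ j ∈ I, S.coroot i (S.root j) = 0}

/-- A subset `K ⊆ Π` is of finite type if the subgroup `W_K` is finite. -/
def FiniteType (K : Set (Fin m)) : Prop := ((S.WI K : Subgroup (V ≃ₗ[ℝ] V)) : Set (V ≃ₗ[ℝ] V)).Finite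

/-- Every connected component of `K` is of finite type. -/
def FinTypeComponents (K : Set (Fin m)) : Prop := ∀ i ∈ K, S.FiniteType (S.comp K i)

/-- A fundamental face of `H`: a face which is empty or whose relative interior meets
the fundamental chamber. -/
def IsFundFace (μ : V) (F : Set V) : Prop :=
  IsFaceOf (S.orbitHull μ) F ∧ (F = ∅ ∨ (intrinsicInterior ℝ F ∩ S.chamber).Nonempty)

/-- The length of `w ∈ W` with respect to the fundamental reflections. -/
def len (w : V ≃ₗ[ℝ] V) : ℕ :=
  sInf {k | ∃ l : List (Fin m), l.length = k ∧ w = (l.map S.s).prod}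

end GCMRealization

end


namespace GCMRealization

variable {m : ℕ} {V : Type*} [NormedAddCommGroup V] [NormedSpace ℝ V]
variable (S : GCMRealization m V)

theorem aux_s_apply (i : Fin m) (v : V) : S.s i v = v - S.coroot i v • S.root i := rfl

theorem aux_diag (i : Fin m) : S.coroot i (S.root i) = 2 := by
  rw [S.pairing, S.A_diag]; norm_num

theorem aux_ss (i : Fin m) (v : V) : S.s i (S.s i v) = v := by
  simp only [aux_s_apply, map_sub, map_smul, smul_eq_mul, aux_diag]
  module

/-- apply a word -/
noncomputable def auxWord (l : List (Fin m)) (v : V) : V := l.foldr (fun i x => S.s i x) v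

/-- orbit of words -/
noncomputable def auxO (μ v : V) : Prop := ∃ l, S.auxWord l μ = v

/-- distance from the base point -/
noncomputable def auxD (μ v : V) : ℕ := sInf {n | ∃ l : List (Fin m), l.length = n ∧ S.auxWord l μ = v}

/-- alternating words -/
noncomputable def auxAlt (i j : Fin m) : ℕ → V → V
  | 0, v => v
  | k + 1, v => S.s i (auxAlt j i k v)

theorem auxO_s {μ v : V} (h : S.auxO μ v) (i : Fin m) : S.auxO μ (S.s i v) := by
  obtain ⟨l, rfl⟩ := h
  exact ⟨i :: l, rfl⟩

theorem auxD_spec {μ v : V} (h : S.auxO μ v) :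
    ∃ l : List (Fin m), l.length = S.auxD μ v ∧ S.auxWord l μ = v := by
  obtain ⟨l, hl⟩ := h
  exact Nat.sInf_mem (s := {n | ∃ l : List (Fin m), l.length = n ∧ S.auxWord l μ = v})
    ⟨_, l, rfl, hl⟩

theorem auxD_le {μ : V} (l : List (Fin m)) : S.auxD μ (S.auxWord l μ) ≤ l.length :=
  Nat.sInf_le ⟨l, rfl, rfl⟩

theorem auxD_s {μ v : V} (h : S.auxO μ v) (i : Fin m) :
    S.auxD μ (S.s i v) ≤ S.auxD μ v + 1 := by
  obtain ⟨l, hl, rfl⟩ := S.auxD_spec h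
  rw [← hl]
  exact S.auxD_le (i :: l)

theorem auxD_desc {μ v : V} (h : S.auxO μ v) :
    v = μ ∨ ∃ i, S.auxD μ (S.s i v) < S.auxD μ v := by
  obtain ⟨l, hl, rfl⟩ := S.auxD_spec h
  cases l with
  | nil => left; rfl
  | cons i l =>
    right
    refine ⟨i, ?_⟩
    rw [← hl]
    have : S.s i (S.auxWord (i :: l) μ) = S.auxWord l μ := S.aux_ss i _
    rw [this]
    have := S.auxD_le (μ := μ) l
    simp only [List.length_cons]; omega

theorem auxAlt_O {μ v : V} (h : S.auxO μ v) (k : ℕ) :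
    ∀ i j, S.auxO μ (S.auxAlt i j k v) := by
  induction k with
  | zero => intro i j; exact h
  | succ k ih => intro i j; exact S.auxO_s (ih j i) i

theorem auxAlt_D {μ v : V} (h : S.auxO μ v) (k : ℕ) :
    ∀ i j, S.auxD μ (S.auxAlt i j k v) ≤ S.auxD μ v + k := by
  induction k with
  | zero => intro i j; exact le_rfl
  | succ k ih =>
    intro i j
    have h1 := S.auxD_s (S.auxAlt_O h k j i) i
    have h2 := ih j i
    change S.auxD μ (S.s i (S.auxAlt j i k v)) ≤ _
    omega

theorem aux_greedy {μ : V} (n : ℕ) : ∀ v, S.auxD μ v = n → S.auxO μ v → ∀ i j,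
    S.auxD μ v ≤ S.auxD μ (S.s i v) → ∃ ν k, S.auxO μ ν ∧ v = S.auxAlt j i k ν ∧
      S.auxD μ ν + k ≤ S.auxD μ v ∧ S.auxD μ ν ≤ S.auxD μ (S.s i ν) ∧
      S.auxD μ ν ≤ S.auxD μ (S.s j ν) := by
  induction n using Nat.strong_induction_on with
  | _ n ih =>
    intro v hn hO i j hi
    by_cases hj : S.auxD μ v ≤ S.auxD μ (S.s j v)
    · exact ⟨v, 0, hO, rfl, le_rfl, hi, hj⟩
    · push Not at hj
      obtain ⟨ν, k, h1, h2, h3, h4, h5⟩ := ih _ (hn ▸ hj) (S.s j v) rfl (S.auxO_s hO j) j i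
        (by rw [aux_ss]; exact hj.le)
      refine ⟨ν, k + 1, h1, ?_, by omega, h5, h4⟩
      change v = S.s j (S.auxAlt i j k ν)
      rw [← h2, aux_ss]

theorem aux_large (i j : Fin m) (h4 : 4 ≤ S.A i j * S.A j i) (ν : V) (k : ℕ) :
    ∀ i j : Fin m, i ≠ j → 4 ≤ S.A i j * S.A j i → 0 ≤ S.coroot i ν → 0 ≤ S.coroot j ν →
    0 ≤ S.coroot i (S.auxAlt j i k ν) ∧
    0 ≤ -(S.A j i : ℝ) * S.coroot i (S.auxAlt j i k ν) + 2 * S.coroot j (S.auxAlt j i k ν) := by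
  induction k with
  | zero =>
    intro i j hij h4 hi hj
    have : (S.A j i : ℝ) ≤ 0 := by exact_mod_cast S.A_offdiag j i hij.symm
    simp only [auxAlt]
    exact ⟨hi, by nlinarith⟩
  | succ k ih =>
    intro i j hij h4 hi hj
    obtain ⟨h1, h2⟩ := ih j i hij.symm (by rwa [mul_comm]) hj hi
    have hq : (S.A j i : ℝ) ≤ 0 := by exact_mod_cast S.A_offdiag j i hij.symm
    have hp : (S.A i j : ℝ) ≤ 0 := by exact_mod_cast S.A_offdiag i j hij
    have h4' : (4 : ℝ) ≤ S.A i j * S.A j i := by exact_mod_cast h4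
    simp only [auxAlt, aux_s_apply, map_sub, map_smul, smul_eq_mul, aux_diag, S.pairing i j]
    generalize S.coroot j (S.auxAlt i j k ν) = y at *
    generalize S.coroot i (S.auxAlt i j k ν) = z at *
    generalize (S.A i j : ℝ) = p at *
    generalize (S.A j i : ℝ) = q at *
    have e1 : 0 ≤ -p * y := mul_nonneg (by linarith) h1
    constructor
    · nlinarith
    · have e2 : 0 ≤ -q * (-p * y + 2 * z) := mul_nonneg (by linarith) h2
      have e3 : 0 ≤ (p * q - 4) * y := mul_nonneg (by linarith) h1
      nlinarith

theorem aux_after {μ ν : V} (hν : S.auxO μ ν) (i j : Fin m) (M : ℕ)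
    (h1 : S.auxAlt i j (M + 2) ν = S.auxAlt j i M ν)
    (h2 : S.auxAlt j i (M + 2) ν = S.auxAlt i j M ν) (k : ℕ) (hk : M + 1 ≤ k) :
    S.auxD μ (S.auxAlt i j (k + 1) ν) + 1 ≤ S.auxD μ ν + k ∧
    S.auxD μ (S.auxAlt j i (k + 1) ν) + 1 ≤ S.auxD μ ν + k := by
  induction k, hk using Nat.le_induction with
  | base =>
    rw [h1, h2]
    have := S.auxAlt_D hν M i j
    have := S.auxAlt_D hν M j i
    omega
  | succ k hk ih =>
    have e1 := S.auxD_s (S.auxAlt_O hν (k + 1) j i) i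
    have e2 := S.auxD_s (S.auxAlt_O hν (k + 1) i j) j
    change S.auxD μ (S.s i (S.auxAlt j i (k + 1) ν)) + 1 ≤ _ ∧
      S.auxD μ (S.s j (S.auxAlt i j (k + 1) ν)) + 1 ≤ _
    omega

theorem aux_braid (i j : Fin m) (ν : V) (a b : ℝ) (M : ℕ)
    (hij : S.coroot i (S.root j) = a) (hji : S.coroot j (S.root i) = b)
    (h : (a = 0 ∧ b = 0 ∧ M = 1) ∨ (a = -1 ∧ b = -1 ∧ M = 2) ∨ (a = -1 ∧ b = -2 ∧ M = 3) ∨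
      (a = -2 ∧ b = -1 ∧ M = 3) ∨ (a = -1 ∧ b = -3 ∧ M = 5) ∨ (a = -3 ∧ b = -1 ∧ M = 5)) :
    S.auxAlt i j (M + 2) ν = S.auxAlt j i M ν := by
  have hii := S.aux_diag i
  have hjj := S.aux_diag j
  rcases h with ⟨rfl, rfl, rfl⟩ | ⟨rfl, rfl, rfl⟩ | ⟨rfl, rfl, rfl⟩ | ⟨rfl, rfl, rfl⟩ |
    ⟨rfl, rfl, rfl⟩ | ⟨rfl, rfl, rfl⟩ <;>
  · simp only [auxAlt, aux_s_apply, map_sub, map_smul, smul_eq_mul, hii, hjj, hij, hji]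
    module

theorem aux_small (i j : Fin m) (ν : V) (a b : ℝ) (M : ℕ)
    (hi : 0 ≤ S.coroot i ν) (hj : 0 ≤ S.coroot j ν)
    (hij : S.coroot i (S.root j) = a) (hji : S.coroot j (S.root i) = b)
    (h : (a = 0 ∧ b = 0 ∧ M = 1) ∨ (a = -1 ∧ b = -1 ∧ M = 2) ∨ (a = -1 ∧ b = -2 ∧ M = 3) ∨
      (a = -2 ∧ b = -1 ∧ M = 3) ∨ (a = -1 ∧ b = -3 ∧ M = 5) ∨ (a = -3 ∧ b = -1 ∧ M = 5))
    (k : ℕ) (hk : k ≤ M) : 0 ≤ S.coroot i (S.auxAlt j i k ν) := by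
  have hii := S.aux_diag i
  have hjj := S.aux_diag j
  rcases h with ⟨rfl, rfl, rfl⟩ | ⟨rfl, rfl, rfl⟩ | ⟨rfl, rfl, rfl⟩ | ⟨rfl, rfl, rfl⟩ |
    ⟨rfl, rfl, rfl⟩ | ⟨rfl, rfl, rfl⟩ <;> interval_cases k <;>
  · simp only [auxAlt, aux_s_apply, map_sub, map_smul, smul_eq_mul, hii, hjj, hij, hji]
    linarith

theorem aux_rank_two {μ ν : V} (hν : S.auxO μ ν) (i j : Fin m) (hne : i ≠ j)
    (hi : 0 ≤ S.coroot i ν) (hj : 0 ≤ S.coroot j ν) (k : ℕ) :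
    0 ≤ S.coroot i (S.auxAlt j i k ν) ∨
    S.auxD μ (S.s i (S.auxAlt j i k ν)) + 1 ≤ S.auxD μ ν + k := by
  by_cases h4 : 4 ≤ S.A i j * S.A j i
  · exact Or.inl (S.aux_large i j h4 ν k i j hne h4 hi hj).1
  · have hp := S.A_offdiag i j hne
    have hq := S.A_offdiag j i hne.symm
    have hz := S.A_zero_iff i j
    have hz' := S.A_zero_iff j i
    have key : ∃ M : ℕ, (S.A i j = 0 ∧ S.A j i = 0 ∧ M = 1) ∨ (S.A i j = -1 ∧ S.A j i = -1 ∧ M = 2)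
      ∨ (S.A i j = -1 ∧ S.A j i = -2 ∧ M = 3) ∨ (S.A i j = -2 ∧ S.A j i = -1 ∧ M = 3)
      ∨ (S.A i j = -1 ∧ S.A j i = -3 ∧ M = 5) ∨ (S.A i j = -3 ∧ S.A j i = -1 ∧ M = 5) := by
      generalize S.A i j = p at *
      generalize S.A j i = q at *
      by_cases hp0 : p = 0
      · exact ⟨1, Or.inl ⟨hp0, hz.1 hp0, rfl⟩⟩
      · have hq0 : q ≠ 0 := fun h => hp0 (hz.2 h)
        have hp1 : p ≤ -1 := by omega
        have hq1 : q ≤ -1 := by omega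
        have hp3 : -3 ≤ p := by nlinarith
        have hq3 : -3 ≤ q := by nlinarith
        clear hz hz' hp hq hp0 hq0
        interval_cases p <;> interval_cases q <;>
          first
          | (exfalso; omega)
          | (refine ⟨2, ?_⟩; omega)
          | (refine ⟨3, ?_⟩; omega)
          | (refine ⟨5, ?_⟩; omega)
    obtain ⟨M, hM⟩ := key
    have hM1 : ((S.A i j : ℝ) = 0 ∧ (S.A j i : ℝ) = 0 ∧ M = 1) ∨
        ((S.A i j : ℝ) = -1 ∧ (S.A j i : ℝ) = -1 ∧ M = 2)
      ∨ ((S.A i j : ℝ) = -1 ∧ (S.A j i : ℝ) = -2 ∧ M = 3)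
      ∨ ((S.A i j : ℝ) = -2 ∧ (S.A j i : ℝ) = -1 ∧ M = 3)
      ∨ ((S.A i j : ℝ) = -1 ∧ (S.A j i : ℝ) = -3 ∧ M = 5)
      ∨ ((S.A i j : ℝ) = -3 ∧ (S.A j i : ℝ) = -1 ∧ M = 5) := by
      exact_mod_cast hM
    have hM2 : ((S.A j i : ℝ) = 0 ∧ (S.A i j : ℝ) = 0 ∧ M = 1) ∨
        ((S.A j i : ℝ) = -1 ∧ (S.A i j : ℝ) = -1 ∧ M = 2)
      ∨ ((S.A j i : ℝ) = -1 ∧ (S.A i j : ℝ) = -2 ∧ M = 3)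
      ∨ ((S.A j i : ℝ) = -2 ∧ (S.A i j : ℝ) = -1 ∧ M = 3)
      ∨ ((S.A j i : ℝ) = -1 ∧ (S.A i j : ℝ) = -3 ∧ M = 5)
      ∨ ((S.A j i : ℝ) = -3 ∧ (S.A i j : ℝ) = -1 ∧ M = 5) := by
      rcases hM1 with ⟨a, b, c⟩ | ⟨a, b, c⟩ | ⟨a, b, c⟩ | ⟨a, b, c⟩ | ⟨a, b, c⟩ | ⟨a, b, c⟩
      · exact Or.inl ⟨b, a, c⟩
      · exact Or.inr (Or.inl ⟨b, a, c⟩)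
      · exact Or.inr (Or.inr (Or.inr (Or.inl ⟨b, a, c⟩)))
      · exact Or.inr (Or.inr (Or.inl ⟨b, a, c⟩))
      · exact Or.inr (Or.inr (Or.inr (Or.inr (Or.inr ⟨b, a, c⟩))))
      · exact Or.inr (Or.inr (Or.inr (Or.inr (Or.inl ⟨b, a, c⟩))))
    by_cases hk : k ≤ M
    · exact Or.inl (S.aux_small i j ν _ _ M hi hj (S.pairing i j) (S.pairing j i) hM1 k hk)
    · right
      refine (S.aux_after hν i j M
        (S.aux_braid i j ν _ _ M (S.pairing i j) (S.pairing j i) hM1)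
        (S.aux_braid j i ν _ _ M (S.pairing j i) (S.pairing i j) hM2) k (by omega)).1

theorem aux_main {μ : V} (hμ : μ ∈ S.chamber) (n : ℕ) : ∀ v, S.auxD μ v = n → S.auxO μ v →
    ∀ i, S.auxD μ v ≤ S.auxD μ (S.s i v) → 0 ≤ S.coroot i v := by
  induction n using Nat.strong_induction_on with
  | _ n ih =>
    intro v hn hO i hi
    rcases S.auxD_desc hO with rfl | ⟨j, hj⟩
    · exact hμ i
    have hne : i ≠ j := by rintro rfl; omega
    obtain ⟨ν, k, h1, h2, h3, h4, h5⟩ := S.aux_greedy n v hn hO i j hi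
    have hk : k ≠ 0 := by
      rintro rfl
      have : v = ν := h2
      subst this
      omega
    have e1 := ih _ (by omega) ν rfl h1 i h4
    have e2 := ih _ (by omega) ν rfl h1 j h5
    rcases S.aux_rank_two h1 i j hne e1 e2 k with h | h
    · rw [h2]; exact h
    · rw [← h2] at h; omega

theorem aux_cone {μ : V} (hμ : μ ∈ S.chamber) (n : ℕ) : ∀ v, S.auxD μ v = n → S.auxO μ v →
    ∃ c : Fin m → ℝ, (∀ i, 0 ≤ c i) ∧ v = μ - ∑ i, c i • S.root i := by
  induction n using Nat.strong_induction_on with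
  | _ n ih =>
    intro v hn hO
    rcases S.auxD_desc hO with rfl | ⟨i, hi⟩
    · exact ⟨0, by simp, by simp⟩
    obtain ⟨c, hc, hv⟩ := ih _ (hn ▸ hi) _ rfl (S.auxO_s hO i)
    have hpos := S.aux_main hμ _ _ rfl (S.auxO_s hO i) i (by rw [aux_ss]; exact hi.le)
    refine ⟨c + Pi.single i (S.coroot i (S.s i v)), ?_, ?_⟩
    · intro t
      have : 0 ≤ (Pi.single i (S.coroot i (S.s i v)) : Fin m → ℝ) t := by
        by_cases ht : t = i
        · subst ht; simpa using hpos
        · simp [ht]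
      exact add_nonneg (hc t) this
    · have e : ∑ t, (Pi.single i (S.coroot i (S.s i v)) : Fin m → ℝ) t • S.root t
          = S.coroot i (S.s i v) • S.root i := by
        rw [Finset.sum_eq_single i]
        · simp
        · intro b _ hb; simp [hb]
        · simp
      simp only [Pi.add_apply, add_smul, Finset.sum_add_distrib, e]
      conv_lhs => rw [← S.aux_ss i v, S.aux_s_apply i (S.s i v)]
      conv_lhs => enter [1]; rw [hv]
      abel

theorem auxO_W {μ : V} {w : V ≃ₗ[ℝ] V} (hw : w ∈ S.W) : ∀ v, S.auxO μ v → S.auxO μ (w v) := by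
  unfold W at hw
  induction hw using Subgroup.closure_induction'' with
  | one => intro v hv; exact hv
  | mem x hx =>
    obtain ⟨i, rfl⟩ := hx
    intro v hv; exact S.auxO_s hv i
  | inv_mem x hx =>
    obtain ⟨i, rfl⟩ := hx
    intro v hv
    have : (S.s i)⁻¹ v = S.s i v := by
      change (S.s i).symm v = _
      rw [LinearEquiv.symm_apply_eq, aux_ss]
    rw [this]; exact S.auxO_s hv i
  | mul x y _ _ hx hy => intro v hv; exact hx _ (hy _ hv)

theorem aux_word_symm {μ v : V} (h : S.auxO μ v) : S.auxO v μ := by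
  obtain ⟨l, rfl⟩ := h
  have key : ∀ l : List (Fin m), ∀ y : V, S.auxO y (S.auxWord l μ) → S.auxO y μ := by
    intro l
    induction l with
    | nil => intro y h; exact h
    | cons i l ih =>
      intro y h
      apply ih
      have := S.auxO_s h i
      have e : S.s i (S.auxWord (i :: l) μ) = S.auxWord l μ := S.aux_ss i _
      rwa [e] at this
  exact key l _ ⟨[], rfl⟩

theorem aux_final {μ : V} (hμ : μ ∈ S.chamber) (I : Set (Fin m)) (n : ℕ) :
    ∀ v, S.auxD μ v = n → S.auxO μ v → ∀ c : Fin m → ℝ, (∀ i, 0 ≤ c i) → (∀ i, i ∉ I → c i = 0) →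
    v = μ - ∑ i, c i • S.root i → ∃ u ∈ S.WI I, v = u μ := by
  induction n using Nat.strong_induction_on with
  | _ n ih =>
    intro v hn hO c hc hcI hv
    by_cases hdom : ∀ i ∈ I, 0 ≤ S.coroot i v
    · have hvC : v ∈ S.chamber := by
        intro i
        by_cases hi : i ∈ I
        · exact hdom i hi
        rw [hv, map_sub, map_sum]
        have h1 := hμ i
        have h2 : ∑ t, S.coroot i (c t • S.root t) ≤ 0 := by
          apply Finset.sum_nonpos
          intro t _
          rw [map_smul, smul_eq_mul, S.pairing]
          by_cases ht : i = t
          · subst ht; rw [hcI i hi]; simp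
          · have : (S.A i t : ℝ) ≤ 0 := by exact_mod_cast S.A_offdiag i t ht
            exact mul_nonpos_of_nonneg_of_nonpos (hc t) this
        linarith
      obtain ⟨c', hc', hv'⟩ := S.aux_cone hvC _ _ rfl (S.aux_word_symm hO)
      have hsum : ∑ i, (c i + c' i) • S.root i = 0 := by
        simp only [add_smul, Finset.sum_add_distrib]
        have e1 : ∑ i, c i • S.root i = μ - v := by rw [hv]; abel
        have e2 : ∑ i, c' i • S.root i = v - μ := by
          conv_rhs => enter [2]; rw [hv']
          abel
        rw [e1, e2]; abel
      have hz := Fintype.linearIndependent_iff.1 S.root_indep _ hsum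
      have hc0 : ∀ i, c i = 0 := fun i => by
        have := hz i; have := hc i; have := hc' i; linarith
      exact ⟨1, one_mem _, by rw [hv]; simp [hc0]⟩
    · push Not at hdom
      obtain ⟨i, hiI, hi⟩ := hdom
      have hlt : S.auxD μ (S.s i v) < S.auxD μ v := by
        by_contra hcon
        push Not at hcon
        have := S.aux_main hμ _ v rfl hO i hcon
        linarith
      obtain ⟨c', hc', hv'⟩ := S.aux_cone hμ _ _ rfl (S.auxO_s hO i)
      have hsum : ∑ t, (c' t - (c t + (Pi.single i (S.coroot i v) : Fin m → ℝ) t)) • S.root t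
          = 0 := by
        have e : ∑ t, (Pi.single i (S.coroot i v) : Fin m → ℝ) t • S.root t
            = S.coroot i v • S.root i := by
          rw [Finset.sum_eq_single i]
          · simp
          · intro b _ hb; simp [hb]
          · simp
        simp only [sub_smul, add_smul, Finset.sum_add_distrib, Finset.sum_sub_distrib, e]
        have e1 : ∑ i, c i • S.root i = μ - v := by rw [hv]; abel
        have e2 : ∑ t, c' t • S.root t = μ - S.s i v := by rw [hv']; abel
        rw [e1, e2, aux_s_apply]; abel
      have hz := Fintype.linearIndependent_iff.1 S.root_indep _ hsum
      obtain ⟨u, hu, huv⟩ := ih _ (hn ▸ hlt) _ rfl (S.auxO_s hO i) c' hc' (by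
        intro t ht
        have h1 := hz t
        have hne : t ≠ i := by rintro rfl; exact ht hiI
        rw [hcI t ht, Pi.single_eq_of_ne hne] at h1
        linarith) hv'
      refine ⟨S.s i * u, mul_mem (Subgroup.subset_closure ⟨i, hiI, rfl⟩) hu, ?_⟩
      change v = S.s i (u μ)
      rw [← huv, aux_ss]

end GCMRealization

open GCMRealization in
theorem statement_0 {m : ℕ} {V : Type*} [NormedAddCommGroup V] [NormedSpace ℝ V]
    (S : GCMRealization m V) (μ : V) (hμ : μ ∈ S.chamber)
    (w : V ≃ₗ[ℝ] V) (hw : w ∈ S.W) (I : Set (Fin m))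
    (h : w μ ∈ (fun v => μ - v) '' S.coneNonneg I) :
    ∃ u ∈ S.WI I, w μ = u μ := by
  obtain ⟨x, ⟨c, hc, hcI, rfl⟩, hx⟩ := h
  exact S.aux_final hμ I _ (w μ) rfl (S.auxO_W hw μ ⟨[], rfl⟩) c hc hcI hx.symm
end

section
/- For every subset I ⊆ Π, F_I = F_{I*}, where I* is the largest μ-connected subset of I. -/
open Set Module

namespace GCMRealization

theorem s_apply_aux {m : ℕ} {V : Type*} [NormedAddCommGroup V] [NormedSpace ℝ V]
    (S : GCMRealization m V) (i : Fin m) (x : V) :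
    S.s i x = x - S.coroot i x • S.root i := by
  rfl

theorem s_inv_aux {m : ℕ} {V : Type*} [NormedAddCommGroup V] [NormedSpace ℝ V]
    (S : GCMRealization m V) (i : Fin m) : (S.s i)⁻¹ = S.s i := by
  apply inv_eq_of_mul_eq_one_left
  ext x
  have h := S.pairing i i
  rw [S.A_diag i] at h
  simp only [LinearEquiv.mul_apply, s_apply_aux, map_sub, map_smul, h, smul_eq_mul,
    LinearEquiv.coe_one, id]
  push_cast
  module

/-- Left induction along words in the generators of `W_K`. -/
theorem WI_induction_aux {m : ℕ} {V : Type*} [NormedAddCommGroup V] [NormedSpace ℝ V]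
    (S : GCMRealization m V) (K : Set (Fin m)) (μ : V) (P : V → Prop) (h1 : P μ)
    (hs : ∀ i ∈ K, ∀ x, P x → P (S.s i x)) :
    ∀ w ∈ S.WI K, P (w μ) := by
  intro w hw
  unfold WI at hw
  induction hw using Subgroup.closure_induction_left with
  | one => simpa using h1
  | mul_left x hx y hy ih =>
    obtain ⟨i, hi, rfl⟩ := hx
    exact hs i hi _ ih
  | inv_mul_cancel x hx y hy ih =>
    obtain ⟨i, hi, rfl⟩ := hx
    rw [s_inv_aux]
    exact hs i hi _ ih

theorem A_zero_aux {m : ℕ} {V : Type*} [NormedAddCommGroup V] [NormedSpace ℝ V]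
    (S : GCMRealization m V) (μ : V) (I : Set (Fin m)) (i j : Fin m) (hi : i ∈ I)
    (hi' : i ∉ S.muPart μ I) (hj : j ∈ S.muPart μ I) : S.A i j = 0 := by
  by_contra hA
  apply hi'
  obtain ⟨hjI, k, hk, hkμ, hr⟩ := hj
  refine ⟨hi, k, hk, hkμ, SimpleGraph.Reachable.trans ?_ hr⟩
  apply SimpleGraph.Adj.reachable
  refine ⟨?_, hA, fun h => hA ((S.A_zero_iff i j).2 h)⟩
  rintro rfl
  exact hi' ⟨hjI, k, hk, hkμ, hr⟩

end GCMRealization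

open GCMRealization in
theorem statement_2 {m : ℕ} {V : Type*} [NormedAddCommGroup V] [NormedSpace ℝ V]
    (S : GCMRealization m V) (μ : V) (hμ : μ ∈ S.chamber)
    (I : Set (Fin m)) :
    S.face μ I = S.face μ (S.muPart μ I) := by
  unfold face
  congr 1
  have hsub : S.muPart μ I ⊆ I := fun j hj => hj.1
  apply Set.Subset.antisymm
  · rintro _ ⟨w, hw, rfl⟩
    refine S.WI_induction_aux I μ (fun x => x ∈ orbitOf (S.WI (S.muPart μ I)) μ)
      ⟨1, one_mem _, rfl⟩ ?_ w hw
    rintro i hi _ ⟨u, hu, rfl⟩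
    by_cases hi' : i ∈ S.muPart μ I
    · exact ⟨S.s i * u, mul_mem (Subgroup.subset_closure ⟨i, hi', rfl⟩) hu, rfl⟩
    · have h0 : S.coroot i (u μ) = 0 := by
        refine S.WI_induction_aux (S.muPart μ I) μ (fun x => S.coroot i x = 0) ?_ ?_ u hu
        · by_contra h
          exact hi' ⟨hi, i, hi, h, SimpleGraph.Reachable.refl _⟩
        · intro j hj x hx
          have hA := S.A_zero_aux μ I i j hi hi' hj
          simp only [s_apply_aux, map_sub, map_smul, hx, S.pairing, hA]
          simp
      refine ⟨u, hu, ?_⟩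
      simp only [s_apply_aux, h0]
      simp
  · rintro _ ⟨w, hw, rfl⟩
    exact ⟨w, Subgroup.closure_mono (Set.image_mono hsub) hw, rfl⟩
end

section
/- Let I ⊆ Π be nonempty and μ-connected, and let β_1, …, β_k be an enumeration of the elements of I such that for every t ∈ {1, …, k} there exist indices s_0 < s_1 < ⋯ < s_l = t with β_{s_0} ∈ J_> and β_{s_{j−1}} adjacent to β_{s_j} for j = 1, …, l. Set η_0 = μ and η_t = r_{β_t}⋯r_{β_1}μ for t = 1, …, k, and let D = conv{η_0, η_1, …, η_k}. Then η_0, …, η_k are affinely independent (so D is a k-dimensional simplex), the affine hull of D is μ + ℝI, and ri(D) ∩ (μ − ℝ_>I) ∩ C_{I_*} ≠ ∅. -/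
open Set Module

theorem aux_simplex {V : Type*} [NormedAddCommGroup V] [NormedSpace ℝ V]
    [FiniteDimensional ℝ V] {ι : Type*} [Fintype ι] [DecidableEq ι] (η : ι → V)
    (f : ι → V →ₗ[ℝ] ℝ) (b : ι → ℝ)
    (hδ : ∀ i j, f i (η j) + b i = if i = j then 1 else 0) :
    AffineIndependent ℝ η ∧
    ∀ p ∈ affineSpan ℝ (Set.range η), (∀ i, 0 < f i p + b i) →
      p ∈ intrinsicInterior ℝ (convexHull ℝ (Set.range η)) := by
  have key : ∀ (w : ι → ℝ) (i : ι), f i (∑ j, w j • η j) = w i - b i * ∑ j, w j := by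
    intro w i
    have : ∀ j, f i (η j) = (if i = j then 1 else 0) - b i := fun j => by
      rw [← hδ i j]; ring
    simp only [map_sum, map_smul, smul_eq_mul, this, mul_sub, Finset.sum_sub_distrib]
    simp [Finset.mul_sum, mul_comm]
  constructor
  · rw [affineIndependent_iff_of_fintype]
    intro w hw h i
    rw [Finset.weightedVSub_eq_linear_combination _ hw] at h
    have := key w i
    rw [h, hw] at this
    simp at this
    exact this.symm
  · intro p hp hpos
    rw [mem_intrinsicInterior]
    have hspan : affineSpan ℝ (convexHull ℝ (Set.range η)) = affineSpan ℝ (Set.range η) :=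
      affineSpan_convexHull _
    refine ⟨⟨p, by rw [hspan]; exact hp⟩, ?_, rfl⟩
    rw [mem_interior]
    refine ⟨(fun x => (x : V)) ⁻¹' {x | ∀ i, 0 < f i x + b i}, ?_, ?_, hpos⟩
    · rintro ⟨x, hx⟩ hxpos
      simp only [Set.mem_preimage, Set.mem_ofPred_eq] at hxpos ⊢
      rw [hspan] at hx
      obtain ⟨w, hw, rfl⟩ := eq_affineCombination_of_mem_affineSpan_of_fintype hx
      rw [Finset.affineCombination_eq_linear_combination _ _ _ hw] at hxpos ⊢
      refine (convex_convexHull ℝ _).sum_mem (fun i _ => ?_) hw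
        (fun i _ => subset_convexHull ℝ _ (Set.mem_range_self i))
      have := hxpos i
      rw [key, hw] at this
      linarith
    · refine IsOpen.preimage continuous_subtype_val ?_
      rw [Set.ofPred_forall]
      refine isOpen_iInter_of_finite fun i => ?_
      have := (f i).continuous_of_finiteDimensional
      exact isOpen_lt continuous_const (this.add continuous_const)

theorem aux_dual {V : Type*} [NormedAddCommGroup V] [NormedSpace ℝ V] {k : ℕ}
    (v : Fin k → V) (hv : LinearIndependent ℝ v) :
    ∃ L : V →ₗ[ℝ] (Fin k → ℝ), ∀ y : Fin k → ℝ, L (∑ s, y s • v s) = y := by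
  have hinj : LinearMap.ker (Fintype.linearCombination ℝ v) = ⊥ := by
    rw [LinearMap.ker_eq_bot]
    exact hv.fintypeLinearCombination_injective
  obtain ⟨L, hL⟩ := LinearMap.exists_leftInverse_of_injective _ hinj
  refine ⟨L, fun y => ?_⟩
  have := LinearMap.congr_fun hL y
  simpa [Fintype.linearCombination_apply] using this

theorem aux_step {m : ℕ} {V : Type*} [NormedAddCommGroup V] [NormedSpace ℝ V]
    (S : GCMRealization m V) (μ : V) (k : ℕ) (β : Fin k → Fin m)
    (η : Fin (k + 1) → V)
    (hη : ∀ t : Fin (k + 1),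
      η t = (((List.ofFn fun j : Fin k => S.s (β j)).take (t : ℕ)).reverse.prod :
        V ≃ₗ[ℝ] V) μ) :
    η 0 = μ ∧ ∀ t : Fin k, η t.succ = η t.castSucc -
      S.coroot (β t) (η t.castSucc) • S.root (β t) := by
  constructor
  · rw [hη]; simp
  · intro t
    have h : η t.succ = S.s (β t) (η t.castSucc) := by
      rw [hη, hη]
      simp only [Fin.val_succ, Fin.val_castSucc]
      rw [List.take_add_one, List.getElem?_eq_getElem (by simp)]
      simp
    rw [h]
    rfl

theorem aux_formula {m : ℕ} {V : Type*} [NormedAddCommGroup V] [NormedSpace ℝ V]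
    (S : GCMRealization m V) (μ : V) (k : ℕ) (β : Fin k → Fin m)
    (η : Fin (k + 1) → V) (h0 : η 0 = μ) (c : Fin k → ℝ)
    (hs : ∀ t : Fin k, η t.succ = η t.castSucc - c t • S.root (β t)) (n : ℕ) (hn : n < k + 1) :
    η ⟨n, hn⟩ = μ - ∑ s : Fin k, (if s.val < n then c s else 0) • S.root (β s) := by
  induction n with
  | zero => simpa using h0
  | succ n ih =>
    have h1 := hs ⟨n, by omega⟩
    have h2 := ih (by omega)
    simp only [Fin.succ_mk, Fin.castSucc_mk] at h1
    rw [h1, h2, sub_sub]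
    congr 1
    have : c ⟨n, by omega⟩ • S.root (β ⟨n, by omega⟩) =
        ∑ s : Fin k, (if s = ⟨n, by omega⟩ then c s else 0) • S.root (β s) := by
      simp [ite_smul]
    rw [this, ← Finset.sum_add_distrib]
    refine Finset.sum_congr rfl fun s _ => ?_
    rw [← add_smul]
    congr 1
    simp only [Fin.ext_iff]
    split_ifs <;> first | omega | simp

theorem aux_pos {m : ℕ} {V : Type*} [NormedAddCommGroup V] [NormedSpace ℝ V]
    (S : GCMRealization m V) (μ : V) (hμ : μ ∈ S.chamber)
    (k : ℕ) (β : Fin k → Fin m) (hinj : Function.Injective β)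
    (horder : ∀ t : Fin k, ∃ (l : ℕ) (c : Fin (l + 1) → Fin k), StrictMono c ∧
        c (Fin.last l) = t ∧ S.coroot (β (c 0)) μ ≠ 0 ∧
        ∀ j : Fin l, S.Adjacent (β (c j.castSucc)) (β (c j.succ)))
    (c : Fin k → ℝ)
    (hc : ∀ t, c t = S.coroot (β t) μ -
      ∑ s : Fin k, (if s < t then c s else 0) * (S.A (β t) (β s) : ℝ)) (t : Fin k) : 0 < c t := by
  have hoff : ∀ s t : Fin k, s ≠ t → (S.A (β t) (β s) : ℝ) ≤ 0 := fun s t h => by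
    exact_mod_cast S.A_offdiag _ _ (fun h' => h (hinj h').symm)
  have main : ∀ n : ℕ, ∀ t : Fin k, t.val = n → 0 < c t := by
    intro n
    induction n using Nat.strong_induction_on with
    | _ n ih =>
      rintro t rfl
      have hterm : ∀ s : Fin k, (if s < t then c s else 0) * (S.A (β t) (β s) : ℝ) ≤ 0 := by
        intro s
        split_ifs with h
        · exact mul_nonpos_of_nonneg_of_nonpos (ih s h s rfl).le (hoff s t h.ne)
        · simp
      have hμt := hμ (β t)
      rw [hc]
      obtain ⟨l, d, hd, hlast, hd0, hadj⟩ := horder t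
      rcases l with _ | l
      · have h0 : d 0 = t := hlast
        rw [h0] at hd0
        have h1 := lt_of_le_of_ne hμt hd0.symm
        have h2 := Finset.sum_nonpos (fun s (_ : s ∈ Finset.univ) => hterm s)
        linarith
      · have ha := hadj (Fin.last l)
        have hlt : d (Fin.last l).castSucc < d (Fin.last l).succ := hd Fin.castSucc_lt_succ
        rw [Fin.succ_last, hlast] at ha hlt
        have h2 : ∑ s : Fin k, (if s < t then c s else 0) * (S.A (β t) (β s) : ℝ) < 0 := by
          refine Finset.sum_neg' (fun s _ => hterm s) ⟨d (Fin.last l).castSucc, Finset.mem_univ _, ?_⟩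
          rw [if_pos hlt]
          refine mul_neg_of_pos_of_neg (ih _ hlt _ rfl) ?_
          exact lt_of_le_of_ne (hoff _ _ hlt.ne) (by exact_mod_cast ha.2.2)
        linarith
  exact main _ t rfl

open GCMRealization in
theorem statement_4 {m : ℕ} {V : Type*} [NormedAddCommGroup V] [NormedSpace ℝ V]
    (S : GCMRealization m V) (μ : V) (hμ : μ ∈ S.chamber)
    (I : Set (Fin m)) (hne : I.Nonempty) (hcon : S.MuConnected μ I)
    (k : ℕ) (β : Fin k → Fin m) (hinj : Function.Injective β) (hran : Set.range β = I)
    (horder : ∀ t : Fin k, ∃ (l : ℕ) (c : Fin (l + 1) → Fin k), StrictMono c ∧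
        c (Fin.last l) = t ∧ S.coroot (β (c 0)) μ ≠ 0 ∧
        ∀ j : Fin l, S.Adjacent (β (c j.castSucc)) (β (c j.succ)))
    (η : Fin (k + 1) → V)
    (hη : ∀ t : Fin (k + 1),
      η t = (((List.ofFn fun j : Fin k => S.s (β j)).take (t : ℕ)).reverse.prod :
        V ≃ₗ[ℝ] V) μ)
    (D : Set V) (hD : D = convexHull ℝ (Set.range η)) :
    AffineIndependent ℝ η ∧
    (affineSpan ℝ D : Set V) =
      (fun v => μ + v) '' (Submodule.span ℝ (S.root '' I) : Set V) ∧
    (intrinsicInterior ℝ D ∩ ((fun v => μ - v) '' S.conePos I) ∩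
      S.openFacet (S.starSet μ I)).Nonempty := by
  haveI := S.finDim
  obtain ⟨h0, hstep⟩ := aux_step S μ k β η hη
  obtain ⟨c, hcdef⟩ : ∃ c : Fin k → ℝ, ∀ t, c t = S.coroot (β t) (η t.castSucc) :=
    ⟨_, fun _ => rfl⟩
  have hs : ∀ t : Fin k, η t.succ = η t.castSucc - c t • S.root (β t) := fun t => by
    rw [hcdef, hstep]
  have hform := aux_formula S μ k β η h0 c hs
  have hc : ∀ t, c t = S.coroot (β t) μ -
      ∑ s : Fin k, (if s < t then c s else 0) * (S.A (β t) (β s) : ℝ) := by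
    intro t
    rw [hcdef, show t.castSucc = ⟨t.val, by omega⟩ from rfl, hform]
    simp only [map_sub, map_sum, map_smul, smul_eq_mul, S.pairing]
    rfl
  have hcpos := aux_pos S μ hμ k β hinj horder c hc
  have hoff : ∀ i j : Fin m, i ≠ j → (S.A i j : ℝ) ≤ 0 := fun i j h => by
    exact_mod_cast S.A_offdiag _ _ h
  obtain ⟨L, hL⟩ := aux_dual (fun s => S.root (β s)) (S.root_indep.comp β hinj)
  -- coordinates
  let Yf : ℕ → V →ₗ[ℝ] ℝ := fun n => if h : 0 < n ∧ n ≤ k then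
    (-(c ⟨n - 1, by omega⟩)⁻¹) • ((LinearMap.proj ⟨n - 1, by omega⟩ : (Fin k → ℝ) →ₗ[ℝ] ℝ) ∘ₗ L)
    else 0
  let Yb : ℕ → ℝ := fun n => if h : 0 < n ∧ n ≤ k then
    (c ⟨n - 1, by omega⟩)⁻¹ * L μ ⟨n - 1, by omega⟩ else if n = 0 then 1 else 0
  have hY : ∀ (y : ℕ → ℝ) (n : ℕ), y 0 = 1 →
      Yf n (μ - ∑ s : Fin k, (y (s.val + 1) * c s) • S.root (β s)) + Yb n =
        if n ≤ k then y n else 0 := by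
    intro y n hy
    by_cases h : 0 < n ∧ n ≤ k
    · simp only [Yf, Yb, dif_pos h, if_pos h.2]
      have hcn := (hcpos ⟨n - 1, by omega⟩).ne'
      simp only [LinearMap.smul_apply, LinearMap.comp_apply, map_sub, LinearMap.proj_apply, hL,
        smul_eq_mul, Nat.sub_add_cancel h.1]
      field_simp
      ring
    · simp only [Yf, Yb, dif_neg h]
      by_cases h' : n = 0
      · subst h'; simp [hy]
      · have : ¬ n ≤ k := by omega
        simp [h', this]
  have hηY : ∀ (t : Fin (k + 1)) (n : ℕ),
      Yf n (η t) + Yb n = if n ≤ t.val then 1 else 0 := by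
    intro t n
    have h1 := hY (fun n => if n ≤ t.val then 1 else 0) n (by simp)
    have h2 : η t = μ - ∑ s : Fin k,
        ((if s.val + 1 ≤ t.val then (1 : ℝ) else 0) * c s) • S.root (β s) := by
      rw [hform t.val t.isLt]
      simp [Nat.succ_le_iff]
    rw [h2, h1]
    have := t.isLt
    split_ifs <;> first | rfl | omega
  obtain ⟨hind, hri⟩ := aux_simplex η (fun t => Yf t.val - Yf (t.val + 1))
    (fun t => Yb t.val - Yb (t.val + 1)) (by
      intro i j
      have h1 := hηY j i.val
      have h2 := hηY j (i.val + 1)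
      have : (Yf i.val - Yf (i.val + 1)) (η j) + (Yb i.val - Yb (i.val + 1)) =
        (Yf i.val (η j) + Yb i.val) - (Yf (i.val + 1) (η j) + Yb (i.val + 1)) := by
        simp only [LinearMap.sub_apply]; ring
      rw [this, h1, h2]
      simp only [Fin.ext_iff]
      split_ifs <;> first | omega | simp)
  have hspan : (affineSpan ℝ (Set.range η) : Set V) =
      (fun v => μ + v) '' (Submodule.span ℝ (S.root '' I) : Set V) := by
    have hrootdir : Submodule.span ℝ (S.root '' I) ≤ (affineSpan ℝ (Set.range η)).direction := by
      rw [Submodule.span_le]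
      rintro _ ⟨i, hi, rfl⟩
      rw [← hran] at hi
      obtain ⟨t, rfl⟩ := hi
      have h1 : η t.castSucc -ᵥ η t.succ ∈ (affineSpan ℝ (Set.range η)).direction :=
        AffineSubspace.vsub_mem_direction (mem_affineSpan ℝ (Set.mem_range_self _))
          (mem_affineSpan ℝ (Set.mem_range_self _))
      have h2 : S.root (β t) = (c t)⁻¹ • (η t.castSucc -ᵥ η t.succ) := by
        rw [hs, vsub_eq_sub, sub_sub_cancel, smul_smul, inv_mul_cancel₀ (hcpos t).ne', one_smul]
      rw [h2]
      exact Submodule.smul_mem _ _ h1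
    have hμmem : μ ∈ affineSpan ℝ (Set.range η) := by
      rw [← h0]; exact mem_affineSpan ℝ (Set.mem_range_self _)
    apply Set.Subset.antisymm
    · have hle : affineSpan ℝ (Set.range η) ≤
          AffineSubspace.mk' μ (Submodule.span ℝ (S.root '' I)) := by
        rw [affineSpan_le]
        rintro _ ⟨t, rfl⟩
        rw [SetLike.mem_coe, AffineSubspace.mem_mk', vsub_eq_sub, hform t.val t.isLt,
          sub_sub_cancel_left]
        refine Submodule.neg_mem _ (Submodule.sum_mem _ fun s _ => Submodule.smul_mem _ _
          (Submodule.subset_span ⟨β s, ?_, rfl⟩))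
        rw [← hran]; exact Set.mem_range_self s
      intro x hx
      have h1 := hle hx
      rw [AffineSubspace.mem_mk', vsub_eq_sub] at h1
      exact ⟨x - μ, h1, by simp⟩
    · rintro _ ⟨v, hv, rfl⟩
      have := AffineSubspace.vadd_mem_of_mem_direction (hrootdir hv) hμmem
      rw [vadd_eq_add, add_comm v μ] at this
      exact this
  subst hD
  rw [affineSpan_convexHull]
  refine ⟨hind, hspan, ?_⟩
  -- the point
  let x : ℕ → ℝ := fun n => (3 : ℝ)⁻¹ ^ n
  have hxpos : ∀ n, 0 < x n := fun n => by positivity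
  have hxsucc : ∀ n, 3 * x (n + 1) = x n := fun n => by simp only [x, pow_succ]; ring
  have hxanti : ∀ a b, a ≤ b → x b ≤ x a := fun a b h =>
    pow_le_pow_of_le_one (by norm_num) (by norm_num) h
  have hcor : ∀ i, S.coroot i (μ - ∑ s : Fin k, (x (s.val + 1) * c s) • S.root (β s)) =
      S.coroot i μ + ∑ s : Fin k, x (s.val + 1) * c s * (-(S.A i (β s) : ℝ)) := by
    intro i
    simp only [map_sub, map_sum, map_smul, smul_eq_mul, S.pairing, mul_neg,
      Finset.sum_neg_distrib]
    ring
  refine ⟨μ - ∑ s : Fin k, (x (s.val + 1) * c s) • S.root (β s), ⟨hri _ ?_ ?_, ?_⟩, ?_, ?_⟩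
  · rw [← SetLike.mem_coe, hspan]
    refine ⟨- ∑ s : Fin k, (x (s.val + 1) * c s) • S.root (β s), ?_, by
      simp only [sub_eq_add_neg]⟩
    refine Submodule.neg_mem _ (Submodule.sum_mem _ fun s _ => Submodule.smul_mem _ _
      (Submodule.subset_span ⟨β s, ?_, rfl⟩))
    rw [← hran]; exact Set.mem_range_self s
  · intro i
    have h1 := hY x i.val (by simp [x])
    have h2 := hY x (i.val + 1) (by simp [x])
    have h3 := hxsucc i.val
    have h4 := hxpos (i.val + 1)
    have h5 : i.val ≤ k := by omega
    rw [if_pos h5] at h1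
    simp only [LinearMap.sub_apply]
    split_ifs at h2 <;> linarith
  · refine ⟨_, ⟨fun i => ∑ s : Fin k, if β s = i then x (s.val + 1) * c s else 0, ?_, ?_, rfl⟩, ?_⟩
    · intro i hi
      rw [← hran] at hi
      obtain ⟨t, rfl⟩ := hi
      simp only [hinj.eq_iff, Finset.sum_ite_eq', Finset.mem_univ, if_true]
      exact mul_pos (hxpos _) (hcpos t)
    · intro i hi
      refine Finset.sum_eq_zero fun s _ => if_neg ?_
      rintro rfl
      exact hi (hran ▸ Set.mem_range_self s)
    · simp only [Finset.sum_smul]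
      rw [Finset.sum_comm]
      simp [ite_smul]
  · rintro i ⟨hi1, hi2, hi3⟩
    rw [hcor, hi1, zero_add]
    refine Finset.sum_eq_zero fun s _ => ?_
    have := hi3 (β s) (hran ▸ Set.mem_range_self s)
    rw [S.pairing] at this
    rw [this]; simp
  · intro i hi
    rw [hcor]
    have hμi : 0 ≤ S.coroot i μ := hμ i
    by_cases hiI : i ∈ I
    · rw [← hran] at hiI
      obtain ⟨t, rfl⟩ := hiI
      have hct := hc t
      have hlow : ∑ s : Fin k, (3 * x (t.val + 1) *
            (-((if s < t then c s else 0) * (S.A (β t) (β s) : ℝ))) -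
            (if s = t then 2 * (x (t.val + 1) * c t) else 0)) ≤
          ∑ s : Fin k, x (s.val + 1) * c s * (-(S.A (β t) (β s) : ℝ)) := by
        refine Finset.sum_le_sum fun s _ => ?_
        rcases lt_trichotomy s t with h | h | h
        · rw [if_pos h, if_neg h.ne, sub_zero, hxsucc]
          have h1 := hxanti (s.val + 1) t.val h
          have h2 := hoff (β t) (β s) (fun e => h.ne' (hinj e))
          have h3 := mul_nonneg (hcpos s).le (neg_nonneg.mpr h2)
          have := mul_le_mul_of_nonneg_right h1 h3
          linarith
        · subst h
          simp [S.A_diag]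
          linarith
        · rw [if_neg h.not_gt, if_neg h.ne']
          have h2 := hoff (β t) (β s) (fun e => h.ne (hinj e))
          have h3 := mul_nonneg (mul_nonneg (hxpos (s.val + 1)).le (hcpos s).le)
            (neg_nonneg.mpr h2)
          linarith
      rw [Finset.sum_sub_distrib, ← Finset.mul_sum, Finset.sum_neg_distrib] at hlow
      simp only [Finset.sum_ite_eq', Finset.mem_univ, if_true] at hlow
      rw [show -∑ s : Fin k, (if s < t then c s else 0) * (S.A (β t) (β s) : ℝ) =
        c t - S.coroot (β t) μ by linarith, hxsucc] at hlow
      have h1 : x t.val ≤ 1 := by simpa [x] using hxanti 0 t.val (Nat.zero_le _)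
      have h2 := mul_le_mul_of_nonneg_right h1 hμi
      have h3 := mul_pos (hxpos (t.val + 1)) (hcpos t)
      have h4 := hxsucc t.val
      have h5 : x t.val * c t = 3 * (x (t.val + 1) * c t) := by rw [← h4]; ring
      nlinarith
    · have hne' : ∀ s, i ≠ β s := by
        rintro s rfl
        exact hiI (hran ▸ Set.mem_range_self s)
      have hterm : ∀ s ∈ Finset.univ, 0 ≤ x (s.val + 1) * c s * (-(S.A i (β s) : ℝ)) :=
        fun s _ => mul_nonneg (mul_nonneg (hxpos _).le (hcpos s).le)
          (neg_nonneg.mpr (hoff _ _ (hne' s)))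
      by_cases hz : S.coroot i μ = 0
      · have hex : ∃ s, S.A i (β s) ≠ 0 := by
          by_contra! hcon'
          refine hi ⟨hz, hiI, fun j hj => ?_⟩
          rw [← hran] at hj
          obtain ⟨s, rfl⟩ := hj
          rw [S.pairing, hcon' s]; simp
        obtain ⟨s, hsne⟩ := hex
        rw [hz, zero_add]
        refine Finset.sum_pos' hterm ⟨s, Finset.mem_univ _, ?_⟩
        refine mul_pos (mul_pos (hxpos _) (hcpos s)) (neg_pos.mpr ?_)
        exact lt_of_le_of_ne (hoff _ _ (hne' s)) (by exact_mod_cast hsne)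
      · have := lt_of_le_of_ne hμi (Ne.symm hz)
        have := Finset.sum_nonneg hterm
        linarith
end

section
/- Let I ⊆ Π be μ-connected. Then ri(F_I) ∩ (μ − ℝ_>I) ∩ C_{I_*} ≠ ∅; in particular F_I is a fundamental face of H. Moreover the affine hull of F_I is μ + ℝI, so the affine dimension of F_I equals |I|. -/
open Set Module

set_option linter.all false
set_option linter.unusedSimpArgs false

namespace GCMRealization
variable {m : ℕ} {V : Type*} [NormedAddCommGroup V] [NormedSpace ℝ V]
variable (S : GCMRealization m V)

lemma s_apply (i : Fin m) (x : V) : S.s i x = x - S.coroot i x • S.root i := rfl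

lemma s_mul_self (i : Fin m) : S.s i * S.s i = 1 := by
  have h2 : S.coroot i (S.root i) = 2 := by
    rw [S.pairing, S.A_diag]; norm_num
  ext x
  show S.s i (S.s i x) = x
  simp only [s_apply, map_sub, map_smul, smul_eq_mul, h2]
  module

lemma s_inv (i : Fin m) : (S.s i)⁻¹ = S.s i := inv_eq_of_mul_eq_one_left (S.s_mul_self i)

/-- `w` is a product of `n` fundamental reflections. -/
def HasWord (w : V ≃ₗ[ℝ] V) (n : ℕ) : Prop :=
  ∃ l : List (Fin m), l.length = n ∧ w = (l.map S.s).prod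

variable {S}

lemma HasWord.one : S.HasWord 1 0 := ⟨[], rfl, by simp⟩

lemma HasWord.mul {w v : V ≃ₗ[ℝ] V} {a b : ℕ} (h : S.HasWord w a) (h' : S.HasWord v b) :
    S.HasWord (w * v) (a + b) := by
  obtain ⟨l, hl, rfl⟩ := h
  obtain ⟨l', hl', rfl⟩ := h'
  exact ⟨l ++ l', by simp [hl, hl'], by simp⟩

lemma HasWord.gen (i : Fin m) : S.HasWord (S.s i) 1 := ⟨[i], rfl, by simp⟩

lemma HasWord.inv {w : V ≃ₗ[ℝ] V} {a : ℕ} (h : S.HasWord w a) : S.HasWord w⁻¹ a := by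
  obtain ⟨l, hl, rfl⟩ := h
  induction l generalizing a with
  | nil => exact ⟨[], hl, by simp⟩
  | cons i l ih =>
    have := (ih rfl).mul (HasWord.gen (S := S) i)
    simp only [List.length_cons] at hl
    rw [hl] at this
    simpa [s_inv] using this

lemma HasWord.mem {w : V ≃ₗ[ℝ] V} {a : ℕ} (h : S.HasWord w a) : w ∈ S.W := by
  obtain ⟨l, hl, rfl⟩ := h
  apply Subgroup.list_prod_mem
  intro x hx
  obtain ⟨i, -, rfl⟩ := List.mem_map.1 hx
  exact Subgroup.subset_closure ⟨i, rfl⟩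

lemma exists_hasWord {w : V ≃ₗ[ℝ] V} (h : w ∈ S.W) : ∃ n, S.HasWord w n := by
  unfold W at h
  induction h using Subgroup.closure_induction with
  | mem x hx => obtain ⟨i, rfl⟩ := hx; exact ⟨1, HasWord.gen i⟩
  | one => exact ⟨0, HasWord.one⟩
  | mul x y _ _ hx hy => obtain ⟨a, ha⟩ := hx; obtain ⟨b, hb⟩ := hy; exact ⟨_, ha.mul hb⟩
  | inv x _ hx => obtain ⟨a, ha⟩ := hx; exact ⟨_, ha.inv⟩

lemma hasWord_len {w : V ≃ₗ[ℝ] V} (h : w ∈ S.W) : S.HasWord w (S.len w) :=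
  Nat.sInf_mem (s := {k | ∃ l : List (Fin m), l.length = k ∧ w = (l.map S.s).prod})
    (exists_hasWord h)

lemma len_le {w : V ≃ₗ[ℝ] V} {n : ℕ} (h : S.HasWord w n) : S.len w ≤ n := Nat.sInf_le h

variable (S)

/-- nonnegative combinations of simple roots -/
def Pos (v : V) : Prop := ∃ c : Fin m → ℝ, (∀ i, 0 ≤ c i) ∧ v = ∑ i, c i • S.root i

variable {S}

lemma Pos.add {v w : V} (h : S.Pos v) (h' : S.Pos w) : S.Pos (v + w) := by
  obtain ⟨c, hc, rfl⟩ := h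
  obtain ⟨d, hd, rfl⟩ := h'
  exact ⟨fun i => c i + d i, fun i => add_nonneg (hc i) (hd i), by
    simp [add_smul, Finset.sum_add_distrib]⟩

lemma Pos.smul {v : V} {a : ℝ} (ha : 0 ≤ a) (h : S.Pos v) : S.Pos (a • v) := by
  obtain ⟨c, hc, rfl⟩ := h
  exact ⟨fun i => a * c i, fun i => mul_nonneg ha (hc i), by
    simp [mul_smul, Finset.smul_sum]⟩

lemma Pos.zero : S.Pos 0 := ⟨fun _ => 0, fun _ => le_rfl, by simp⟩

lemma Pos.root (i : Fin m) : S.Pos (S.root i) :=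
  ⟨fun j => if j = i then 1 else 0, fun j => by dsimp only; split_ifs <;> norm_num, by simp⟩

variable (S)

/-- letters of the alternating word (from the right) -/
def altL (i j : Fin m) (k : ℕ) : Fin m := if Even k then j else i

/-- alternating word of length `k`, ending in `j` -/
def alt (i j : Fin m) : ℕ → (V ≃ₗ[ℝ] V)
  | 0 => 1
  | k + 1 => S.s (altL i j k) * alt i j k

lemma alt_hasWord (i j : Fin m) (k : ℕ) : S.HasWord (S.alt i j k) k := by
  induction k with
  | zero => exact HasWord.one
  | succ k ih => have := (HasWord.gen (S := S) (altL i j k)).mul ih; rwa [add_comm] at this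

lemma s_root (i j : Fin m) : S.s i (S.root j) = S.root j - (S.A i j : ℝ) • S.root i := by
  rw [s_apply, S.pairing]

lemma s_root_self (i : Fin m) : S.s i (S.root i) = - S.root i := by
  rw [s_root, S.A_diag]; push_cast; module

/-- Infinite dihedral case. -/
lemma alt_pos_inf {i j : Fin m} (hij : i ≠ j) (h4 : 4 ≤ S.A i j * S.A j i) (k : ℕ) :
    ∃ p q : ℝ, 0 ≤ p ∧ 0 ≤ q ∧ S.alt i j k (S.root i) = p • S.root i + q • S.root j ∧
      (Even k → 2 * q ≤ - S.A j i * p) ∧ (¬ Even k → 2 * p ≤ - S.A i j * q) := by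
  have ha : (0 : ℝ) ≤ - S.A i j := by
    have := S.A_offdiag i j hij
    exact_mod_cast neg_nonneg.2 this
  have hb : (0 : ℝ) ≤ - S.A j i := by
    have := S.A_offdiag j i hij.symm
    exact_mod_cast neg_nonneg.2 this
  have h4' : (4 : ℝ) ≤ (- S.A i j) * (- S.A j i) := by
    rw [neg_mul_neg]; exact_mod_cast h4
  have hii := S.A_diag i
  have hjj := S.A_diag j
  induction k with
  | zero =>
    refine ⟨1, 0, zero_le_one, le_rfl, ?_, ?_, ?_⟩
    · simp [alt]
    · intro _; linarith
    · intro h; exact absurd Even.zero h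
  | succ k ih =>
    obtain ⟨p, q, hp, hq, he, h1, h2⟩ := ih
    by_cases hk : Even k
    · have h1 := h1 hk
      refine ⟨p, - S.A j i * p - q, hp, by linarith, ?_, ?_, ?_⟩
      · show S.s (altL i j k) (S.alt i j k (S.root i)) = _
        rw [he, altL, if_pos hk, map_add, map_smul, map_smul, s_root_self, s_root]
        module
      · intro h; exact absurd hk (Nat.even_add_one.1 h)
      · intro _
        nlinarith [mul_le_mul_of_nonneg_left h1 ha, mul_le_mul_of_nonneg_right h4' hp]
    · have h2 := h2 hk
      refine ⟨- S.A i j * q - p, q, by linarith, hq, ?_, ?_, ?_⟩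
      · show S.s (altL i j k) (S.alt i j k (S.root i)) = _
        rw [he, altL, if_neg hk, map_add, map_smul, map_smul, s_root_self, s_root]
        module
      · intro _
        nlinarith [mul_le_mul_of_nonneg_left h2 hb, mul_le_mul_of_nonneg_right h4' hq]
      · intro h; exact absurd (Nat.even_add_one.2 hk) h

lemma alt_shorter {i j : Fin m} {M : ℕ} (hM : S.HasWord (S.alt i j (M + 1) * S.s i) M) (k : ℕ) :
    S.HasWord (S.alt i j (M + 1 + k) * S.s i) (M + k) := by
  induction k with
  | zero => exact hM
  | succ k ih =>
    have := (HasWord.gen (S := S) (altL i j (M + 1 + k))).mul ih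
    rw [← mul_assoc] at this
    rw [add_comm 1] at this
    exact this

/-- Finite dihedral case. -/
lemma alt_pos_fin {i j : Fin m} (hij : i ≠ j) (h4 : S.A i j * S.A j i < 4) :
    ∃ M : ℕ, S.HasWord (S.alt i j (M + 1) * S.s i) M ∧
     ∀ k ≤ M, ∃ p q : ℝ, 0 ≤ p ∧ 0 ≤ q ∧ S.alt i j k (S.root i) = p • S.root i + q • S.root j := by
  have ha := S.A_offdiag i j hij
  have hb := S.A_offdiag j i hij.symm
  have h0 := S.A_zero_iff i j
  have hii := S.pairing i i
  have hjj := S.pairing j j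
  have hpij := S.pairing i j
  have hpji := S.pairing j i
  rw [S.A_diag] at hii hjj
  obtain ⟨a, hA⟩ : ∃ a, a = S.A i j := ⟨_, rfl⟩
  obtain ⟨b, hB⟩ : ∃ b, b = S.A j i := ⟨_, rfl⟩
  rw [← hA] at ha h0 h4 hpij
  rw [← hB] at hb h0 h4 hpji
  have hcases : (a = 0 ∧ b = 0) ∨ (a = -1 ∧ b = -1) ∨ (a = -1 ∧ b = -2) ∨ (a = -2 ∧ b = -1)
      ∨ (a = -1 ∧ b = -3) ∨ (a = -3 ∧ b = -1) := by
    by_cases ha0 : a = 0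
    · exact Or.inl ⟨ha0, h0.1 ha0⟩
    have hb0 : b ≠ 0 := fun h => ha0 (h0.2 h)
    have ha1 : a ≤ -1 := by omega
    have hb1 : b ≤ -1 := by omega
    have ha3 : -3 ≤ a := by nlinarith
    have hb3 : -3 ≤ b := by nlinarith
    clear hA hB hpij hpji hij hii hjj
    interval_cases a <;> interval_cases b <;> simp_all
  have hl : ∀ n, ∀ l : List (Fin m), l.length = n → S.HasWord (l.map S.s).prod n :=
    fun n l h => ⟨l, h, rfl⟩
  rcases hcases with ⟨rfl, rfl⟩ | ⟨rfl, rfl⟩ | ⟨rfl, rfl⟩ | ⟨rfl, rfl⟩ | ⟨rfl, rfl⟩ | ⟨rfl, rfl⟩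
  · refine ⟨1, ?_, ?_⟩
    · convert hl 1 [j] rfl using 1
      ext x
      simp [alt, altL, s_apply, hii, hjj, hpij, hpji, Nat.even_add_one]
      try module
    · intro k hk
      interval_cases k
      · exact ⟨1, 0, by norm_num, by norm_num, by simp [alt]⟩
      · exact ⟨1, 0, by norm_num, by norm_num, by
          simp [alt, altL, s_apply, hii, hjj, hpij, hpji, Nat.even_add_one]⟩
  · refine ⟨2, ?_, ?_⟩
    · convert hl 2 [i, j] rfl using 1
      ext x
      simp [alt, altL, s_apply, hii, hjj, hpij, hpji, Nat.even_add_one]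
      module
    · intro k hk
      interval_cases k
      · exact ⟨1, 0, by norm_num, by norm_num, by simp [alt]⟩
      · exact ⟨1, 1, by norm_num, by norm_num, by
          simp [alt, altL, s_apply, hii, hjj, hpij, hpji, Nat.even_add_one]⟩
      · exact ⟨0, 1, by norm_num, by norm_num, by
          simp [alt, altL, s_apply, hii, hjj, hpij, hpji, Nat.even_add_one]; try module⟩
  · refine ⟨3, ?_, ?_⟩
    · convert hl 3 [j, i, j] rfl using 1
      ext x
      simp [alt, altL, s_apply, hii, hjj, hpij, hpji, Nat.even_add_one]
      module
    · intro k hk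
      interval_cases k
      · exact ⟨1, 0, by norm_num, by norm_num, by simp [alt]⟩
      · exact ⟨1, 2, by norm_num, by norm_num, by
          simp [alt, altL, s_apply, hii, hjj, hpij, hpji, Nat.even_add_one]⟩
      · exact ⟨1, 2, by norm_num, by norm_num, by
          simp [alt, altL, s_apply, hii, hjj, hpij, hpji, Nat.even_add_one]; try module⟩
      · exact ⟨1, 0, by norm_num, by norm_num, by
          simp [alt, altL, s_apply, hii, hjj, hpij, hpji, Nat.even_add_one]; try module⟩
  · refine ⟨3, ?_, ?_⟩
    · convert hl 3 [j, i, j] rfl using 1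
      ext x
      simp [alt, altL, s_apply, hii, hjj, hpij, hpji, Nat.even_add_one]
      module
    · intro k hk
      interval_cases k
      · exact ⟨1, 0, by norm_num, by norm_num, by simp [alt]⟩
      · exact ⟨1, 1, by norm_num, by norm_num, by
          simp [alt, altL, s_apply, hii, hjj, hpij, hpji, Nat.even_add_one]⟩
      · exact ⟨1, 1, by norm_num, by norm_num, by
          simp [alt, altL, s_apply, hii, hjj, hpij, hpji, Nat.even_add_one]; try module⟩
      · exact ⟨1, 0, by norm_num, by norm_num, by
          simp [alt, altL, s_apply, hii, hjj, hpij, hpji, Nat.even_add_one]; try module⟩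
  · refine ⟨5, ?_, ?_⟩
    · convert hl 5 [j, i, j, i, j] rfl using 1
      ext x
      simp [alt, altL, s_apply, hii, hjj, hpij, hpji, Nat.even_add_one]
      module
    · intro k hk
      interval_cases k
      · exact ⟨1, 0, by norm_num, by norm_num, by simp [alt]⟩
      · exact ⟨1, 3, by norm_num, by norm_num, by
          simp [alt, altL, s_apply, hii, hjj, hpij, hpji, Nat.even_add_one]⟩
      · exact ⟨2, 3, by norm_num, by norm_num, by
          simp [alt, altL, s_apply, hii, hjj, hpij, hpji, Nat.even_add_one]; try module⟩
      · exact ⟨2, 3, by norm_num, by norm_num, by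
          simp [alt, altL, s_apply, hii, hjj, hpij, hpji, Nat.even_add_one]; try module⟩
      · exact ⟨1, 3, by norm_num, by norm_num, by
          simp [alt, altL, s_apply, hii, hjj, hpij, hpji, Nat.even_add_one]; try module⟩
      · exact ⟨1, 0, by norm_num, by norm_num, by
          simp [alt, altL, s_apply, hii, hjj, hpij, hpji, Nat.even_add_one]; try module⟩
  · refine ⟨5, ?_, ?_⟩
    · convert hl 5 [j, i, j, i, j] rfl using 1
      ext x
      simp [alt, altL, s_apply, hii, hjj, hpij, hpji, Nat.even_add_one]
      module
    · intro k hk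
      interval_cases k
      · exact ⟨1, 0, by norm_num, by norm_num, by simp [alt]⟩
      · exact ⟨1, 1, by norm_num, by norm_num, by
          simp [alt, altL, s_apply, hii, hjj, hpij, hpji, Nat.even_add_one]⟩
      · exact ⟨2, 1, by norm_num, by norm_num, by
          simp [alt, altL, s_apply, hii, hjj, hpij, hpji, Nat.even_add_one]; try module⟩
      · exact ⟨2, 1, by norm_num, by norm_num, by
          simp [alt, altL, s_apply, hii, hjj, hpij, hpji, Nat.even_add_one]; try module⟩
      · exact ⟨1, 1, by norm_num, by norm_num, by
          simp [alt, altL, s_apply, hii, hjj, hpij, hpji, Nat.even_add_one]; try module⟩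
      · exact ⟨1, 0, by norm_num, by norm_num, by
          simp [alt, altL, s_apply, hii, hjj, hpij, hpji, Nat.even_add_one]; try module⟩

lemma altL_eq (i j : Fin m) (k : ℕ) :
    (altL i j k = i ∧ altL i j (k + 1) = j) ∨ (altL i j k = j ∧ altL i j (k + 1) = i) := by
  by_cases hk : Even k <;> simp [altL, hk, Nat.even_add_one]

/-- The sign lemma: if `l(w r_i) ≥ l(w)` then `w α_i ≥ 0`. -/
lemma sign_lemma (n : ℕ) : ∀ w ∈ S.W, S.len w = n → ∀ i, S.len w ≤ S.len (w * S.s i) →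
    S.Pos (w (S.root i)) := by
  induction n using Nat.strong_induction_on with
  | _ n ih =>
  intro w hw hn i hi
  rcases Nat.eq_zero_or_pos n with h0 | hpos
  · obtain ⟨l, hl, rfl⟩ := hasWord_len hw
    rw [hn, h0, List.length_eq_zero_iff] at hl
    subst hl
    simpa using Pos.root i
  -- last letter
  obtain ⟨j, w1, hw1, hw1n, hwe⟩ : ∃ j w1, w1 ∈ S.W ∧ S.len w1 + 1 = n ∧ w = w1 * S.s j := by
    obtain ⟨l, hl, hwl⟩ := hasWord_len hw
    rcases List.eq_nil_or_concat l with rfl | ⟨l', j, rfl⟩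
    · simp at hl; omega
    · have h1 : S.HasWord (l'.map S.s).prod l'.length := ⟨l', rfl, rfl⟩
      have h2 : w = (l'.map S.s).prod * S.s j := by simpa using hwl
      refine ⟨j, _, h1.mem, ?_, h2⟩
      have h3 := len_le h1
      have h4 := len_le ((hasWord_len h1.mem).mul (HasWord.gen (S := S) j))
      rw [← h2] at h4
      simp at hl
      omega
  have hij : i ≠ j := by
    rintro rfl
    rw [hwe, mul_assoc, s_mul_self, mul_one, ← hwe] at hi
    omega
  let Q : ℕ → Prop := fun k => ∃ v ∈ S.W, w = v * S.alt i j k ∧ S.len v + k = n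
  have hQ1 : Q 1 := ⟨w1, hw1, by simp [alt, altL, hwe], hw1n⟩
  obtain ⟨k, hk1, hQk, hmax⟩ : ∃ k, 1 ≤ k ∧ Q k ∧ ¬ Q (k + 1) := by
    by_contra hcon
    push Not at hcon
    have : ∀ k, Q (k + 1) := fun k => by
      induction k with
      | zero => exact hQ1
      | succ k ihk => exact hcon (k + 1) (by omega) ihk
    obtain ⟨v, -, -, h⟩ := this n
    omega
  obtain ⟨v, hv, hvw, hvn⟩ := hQk
  have hsW : ∀ x, S.s x ∈ S.W := fun x => (HasWord.gen x).mem
  have hx : S.len v ≤ S.len (v * S.s (altL i j k)) := by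
    by_contra hlt
    push Not at hlt
    apply hmax
    have hm := S.W.mul_mem hv (hsW (altL i j k))
    refine ⟨v * S.s (altL i j k), hm, ?_, ?_⟩
    · rw [alt, mul_assoc, ← mul_assoc (S.s _), s_mul_self, one_mul, hvw]
    · have e : w = (v * S.s (altL i j k)) * S.alt i j (k + 1) := by
        rw [alt, mul_assoc, ← mul_assoc (S.s _), s_mul_self, one_mul, hvw]
      have := len_le ((hasWord_len hm).mul (S.alt_hasWord i j (k + 1)))
      rw [← e] at this
      omega
  obtain ⟨k, rfl⟩ : ∃ k', k = k' + 1 := ⟨k - 1, by omega⟩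
  have hy : S.len v ≤ S.len (v * S.s (altL i j k)) := by
    by_contra hlt
    push Not at hlt
    have hm := S.W.mul_mem hv (hsW (altL i j k))
    have e : w = (v * S.s (altL i j k)) * S.alt i j k := by
      rw [hvw, alt, mul_assoc]
    have := len_le ((hasWord_len hm).mul (S.alt_hasWord i j k))
    rw [← e] at this
    omega
  have hpx := ih _ (by omega) v hv rfl _ hx
  have hpy := ih _ (by omega) v hv rfl _ hy
  have hboth : S.Pos (v (S.root i)) ∧ S.Pos (v (S.root j)) := by
    rcases altL_eq i j k with ⟨h1, h2⟩ | ⟨h1, h2⟩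
    · rw [h2] at hpx; rw [h1] at hpy; exact ⟨hpy, hpx⟩
    · rw [h2] at hpx; rw [h1] at hpy; exact ⟨hpx, hpy⟩
  obtain ⟨p, q, hp, hq, he⟩ : ∃ p q : ℝ, 0 ≤ p ∧ 0 ≤ q ∧
      S.alt i j (k + 1) (S.root i) = p • S.root i + q • S.root j := by
    rcases le_or_gt 4 (S.A i j * S.A j i) with h4 | h4
    · obtain ⟨p, q, hp, hq, he, -⟩ := S.alt_pos_inf hij h4 (k + 1)
      exact ⟨p, q, hp, hq, he⟩
    · obtain ⟨M, hM, hMk⟩ := S.alt_pos_fin hij h4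
      apply hMk
      by_contra hlt
      push Not at hlt
      obtain ⟨d, rfl⟩ : ∃ d, k = M + d := ⟨k - M, by omega⟩
      have h1 := S.alt_shorter hM d
      have h2 := len_le ((hasWord_len hv).mul h1)
      rw [← mul_assoc, show M + 1 + d = M + d + 1 by ring, ← hvw] at h2
      omega
  have : w (S.root i) = p • v (S.root i) + q • v (S.root j) := by
    rw [hvw]
    show v (S.alt i j (k + 1) (S.root i)) = _
    rw [he, map_add, map_smul, map_smul]
  rw [this]
  exact (hboth.1.smul hp).add (hboth.2.smul hq)

/-- `μ - w μ ≥ 0` -/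
lemma sub_pos {μ : V} (hμ : μ ∈ S.chamber) (n : ℕ) : ∀ w ∈ S.W, S.len w = n → S.Pos (μ - w μ) := by
  induction n with
  | zero =>
    intro w hw hn
    obtain ⟨l, hl, rfl⟩ := hasWord_len hw
    rw [hn, List.length_eq_zero_iff] at hl
    subst hl
    simpa using Pos.zero
  | succ n ih =>
    intro w hw hn
    obtain ⟨l, hl, hwl⟩ := hasWord_len hw
    rcases List.eq_nil_or_concat l with rfl | ⟨l', j, rfl⟩
    · simp at hl; omega
    · have h1 : S.HasWord (l'.map S.s).prod l'.length := ⟨l', rfl, rfl⟩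
      have h2 : w = (l'.map S.s).prod * S.s j := by simpa using hwl
      have h3 := len_le h1
      have h4 := len_le ((hasWord_len h1.mem).mul (HasWord.gen (S := S) j))
      rw [← h2] at h4
      simp at hl
      have h5 := ih _ h1.mem (by omega)
      have h6 := S.sign_lemma _ _ h1.mem rfl j (by rw [← h2]; omega)
      have h7 := h5.add (h6.smul (hμ j))
      convert h7 using 1
      rw [h2]
      show μ - (l'.map S.s).prod (S.s j μ) = _
      rw [s_apply, map_sub, map_smul]
      abel

end GCMRealization

namespace GCMRealization
variable {m : ℕ} {V : Type*} [NormedAddCommGroup V] [NormedSpace ℝ V]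
variable (S : GCMRealization m V)

lemma exists_functional (c : Fin m → ℝ) : ∃ f : V →ₗ[ℝ] ℝ, ∀ i, f (S.root i) = c i := by
  obtain ⟨f, hf⟩ := LinearMap.exists_extend ((Basis.span S.root_indep).constr ℝ c)
  refine ⟨f, fun i => ?_⟩
  have h := LinearMap.congr_fun hf (Basis.span S.root_indep i)
  rw [Basis.constr_basis] at h
  rw [← h]
  simp [Basis.span_apply]

lemma functional_sum {c : Fin m → ℝ} {f : V →ₗ[ℝ] ℝ} (hf : ∀ i, f (S.root i) = c i)
    (d : Fin m → ℝ) : f (∑ i, d i • S.root i) = ∑ i, d i * c i := by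
  simp [map_sum, hf]

lemma pos_antisymm {v : V} (h : S.Pos v) (h' : S.Pos (-v)) : v = 0 := by
  obtain ⟨c, hc, h1⟩ := h
  obtain ⟨d, hd, h2⟩ := h'
  obtain ⟨f, hf⟩ := S.exists_functional (fun _ => 1)
  have e1 : f v = ∑ i, c i * 1 := by rw [h1]; exact S.functional_sum hf c
  have e2 : f (-v) = ∑ i, d i * 1 := by rw [h2]; exact S.functional_sum hf d
  rw [map_neg] at e2
  simp only [mul_one] at e1 e2
  have p1 : 0 ≤ ∑ i, c i := Finset.sum_nonneg fun i _ => hc i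
  have p2 : 0 ≤ ∑ i, d i := Finset.sum_nonneg fun i _ => hd i
  have h0 : ∑ i, c i = 0 := by linarith
  rw [Finset.sum_eq_zero_iff_of_nonneg (fun i _ => hc i)] at h0
  rw [h1]
  exact Finset.sum_eq_zero fun i hi => by rw [h0 i hi, zero_smul]

lemma s_mem_WI {I : Set (Fin m)} {i : Fin m} (hi : i ∈ I) : S.s i ∈ S.WI I :=
  Subgroup.subset_closure ⟨i, hi, rfl⟩

lemma WI_le (I : Set (Fin m)) : S.WI I ≤ S.W :=
  Subgroup.closure_mono (Set.image_subset_range _ _)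

lemma root_mem_span {I : Set (Fin m)} {i : Fin m} (hi : i ∈ I) :
    S.root i ∈ Submodule.span ℝ (S.root '' I) := Submodule.subset_span ⟨i, hi, rfl⟩

lemma s_sub_mem {I : Set (Fin m)} {i : Fin m} (hi : i ∈ I) (x : V) :
    x - S.s i x ∈ Submodule.span ℝ (S.root '' I) := by
  rw [s_apply, sub_sub_cancel]
  exact Submodule.smul_mem _ _ (S.root_mem_span hi)

lemma WI_sub_mem {I : Set (Fin m)} {w : V ≃ₗ[ℝ] V} (hw : w ∈ S.WI I) :
    ∀ x, x - w x ∈ Submodule.span ℝ (S.root '' I) := by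
  unfold WI at hw
  induction hw using Subgroup.closure_induction with
  | mem w hw => obtain ⟨i, hi, rfl⟩ := hw; exact S.s_sub_mem hi
  | one => intro x; simp
  | mul v w _ _ hv hw =>
    intro x
    have := Submodule.add_mem _ (hw x) (hv (w x))
    simpa using this
  | inv w _ hw =>
    intro x
    have := Submodule.neg_mem _ (hw (w⁻¹ x))
    have e : w (w⁻¹ x) = x := by
      show (w * w⁻¹) x = x
      simp
    rw [e, neg_sub] at this
    exact this

lemma coord_off {I : Set (Fin m)} {c : Fin m → ℝ}
    (h : ∑ i, c i • S.root i ∈ Submodule.span ℝ (S.root '' I)) {i : Fin m} (hi : i ∉ I) :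
    c i = 0 := by
  obtain ⟨f, hf⟩ := S.exists_functional (fun j => if j = i then 1 else 0)
  have h1 : Submodule.span ℝ (S.root '' I) ≤ LinearMap.ker f := by
    rw [Submodule.span_le]
    rintro _ ⟨j, hj, rfl⟩
    have : j ≠ i := fun h => hi (h ▸ hj)
    simp [hf, this]
  have h2 := h1 h
  rw [LinearMap.mem_ker, S.functional_sum hf] at h2
  simpa using h2

lemma len_inv {w : V ≃ₗ[ℝ] V} (hw : w ∈ S.W) : S.len w⁻¹ = S.len w := by
  apply le_antisymm (len_le (hasWord_len hw).inv)
  have := len_le (hasWord_len (S.W.inv_mem hw)).inv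
  rwa [inv_inv] at this

lemma orbit_mem_of_span {μ : V} (hμ : μ ∈ S.chamber) {I : Set (Fin m)} (n : ℕ) :
    ∀ w ∈ S.W, S.len w = n → μ - w μ ∈ Submodule.span ℝ (S.root '' I) →
      w μ ∈ orbitOf (S.WI I) μ := by
  induction n using Nat.strong_induction_on with
  | _ n ih =>
  intro w hw hn hsp
  have hsW : ∀ x, S.s x ∈ S.W := fun x => (HasWord.gen x).mem
  by_cases hex : ∃ i ∈ I, S.len (S.s i * w) < S.len w
  · obtain ⟨i, hi, hlt⟩ := hex
    have h1 := Submodule.add_mem _ hsp (S.s_sub_mem hi (w μ))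
    rw [sub_add_sub_cancel] at h1
    obtain ⟨v, hv, hve⟩ := ih _ (by omega) (S.s i * w) (S.W.mul_mem (hsW i) hw) rfl h1
    refine ⟨S.s i * v, (S.WI I).mul_mem (S.s_mem_WI hi) hv, ?_⟩
    show S.s i (v μ) = w μ
    have hve' : v μ = S.s i (w μ) := hve
    rw [hve']
    show (S.s i * S.s i) (w μ) = w μ
    rw [s_mul_self]; rfl
  · push Not at hex
    obtain ⟨c, hc, he⟩ := S.sub_pos hμ _ w hw rfl
    have hoff : ∀ i, i ∉ I → c i = 0 := fun i hi => S.coord_off (he ▸ hsp) hi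
    have hp : ∀ i, S.Pos (c i • w⁻¹ (S.root i)) := by
      intro i
      by_cases hi : i ∈ I
      · refine Pos.smul (hc i) (S.sign_lemma _ _ (S.W.inv_mem hw) rfl i ?_)
        have e : w⁻¹ * S.s i = (S.s i * w)⁻¹ := by rw [mul_inv_rev, s_inv]
        rw [e, S.len_inv hw, S.len_inv (S.W.mul_mem (hsW i) hw)]
        exact hex i hi
      · rw [hoff i hi, zero_smul]; exact Pos.zero
    have hw' : w⁻¹ (w μ) = μ := by
      show (w⁻¹ * w) μ = μ
      simp
    have h1 : S.Pos (w⁻¹ (μ - w μ)) := by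
      rw [he, map_sum]
      apply Finset.sum_induction _ (fun v => S.Pos v) (fun _ _ h h' => h.add h') Pos.zero
      intro i _
      rw [map_smul]
      exact hp i
    rw [map_sub, hw'] at h1
    have h2 := S.sub_pos hμ _ w⁻¹ (S.W.inv_mem hw) rfl
    rw [← neg_sub] at h2
    have h3 := S.pos_antisymm h1 h2
    have h4 : w⁻¹ μ = μ := sub_eq_zero.1 h3
    refine ⟨1, (S.WI I).one_mem, ?_⟩
    show μ = w μ
    conv_rhs => rw [← h4]
    show μ = (w * w⁻¹) μ
    simp

/-- the point `μ - ∑ c_i α_i` -/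
def pt (μ : V) (c : Fin m → ℝ) : V := μ - ∑ i, c i • S.root i

lemma pt_combo (μ : V) (c d : Fin m → ℝ) {a b : ℝ} (hab : a + b = 1) :
    a • S.pt μ c + b • S.pt μ d = S.pt μ (fun i => a * c i + b * d i) := by
  have : μ = a • μ + b • μ := by rw [← add_smul, hab, one_smul]
  simp only [pt, add_smul, mul_smul, Finset.sum_add_distrib, ← Finset.smul_sum, smul_sub]
  conv_rhs => rw [this]
  abel

lemma mem_face_pt {μ : V} (hμ : μ ∈ S.chamber) {I : Set (Fin m)} {x : V} (hx : x ∈ S.face μ I) :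
    ∃ c : Fin m → ℝ, (∀ i, 0 ≤ c i) ∧ (∀ i, i ∉ I → c i = 0) ∧ x = S.pt μ c := by
  have : S.face μ I ⊆ {x | ∃ c : Fin m → ℝ, (∀ i, 0 ≤ c i) ∧ (∀ i, i ∉ I → c i = 0) ∧
      x = S.pt μ c} := by
    apply convexHull_min
    · rintro _ ⟨w, hw, rfl⟩
      obtain ⟨c, hc, he⟩ := S.sub_pos hμ _ w (S.WI_le I hw) rfl
      refine ⟨c, hc, fun i hi => S.coord_off (he ▸ S.WI_sub_mem hw μ) hi, ?_⟩
      rw [pt, ← he, sub_sub_cancel]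
    · rintro x ⟨c, hc, hcI, rfl⟩ y ⟨d, hd, hdI, rfl⟩ a b ha hb hab
      exact ⟨_, fun i => add_nonneg (mul_nonneg ha (hc i)) (mul_nonneg hb (hd i)),
        fun i hi => by simp [hcI i hi, hdI i hi], S.pt_combo μ c d hab⟩
  exact this hx

lemma mu_mem_face (μ : V) (I : Set (Fin m)) : μ ∈ S.face μ I :=
  subset_convexHull _ _ ⟨1, (S.WI I).one_mem, rfl⟩

lemma s_mem_face {μ : V} {I : Set (Fin m)} {i : Fin m} (hi : i ∈ I) {x : V}
    (hx : x ∈ S.face μ I) : S.s i x ∈ S.face μ I := by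
  have h1 : S.face μ I ⊆ (S.s i).toLinearMap ⁻¹' S.face μ I := by
    apply convexHull_min
    · rintro _ ⟨w, hw, rfl⟩
      exact subset_convexHull _ _ ⟨S.s i * w, (S.WI I).mul_mem (S.s_mem_WI hi) hw, rfl⟩
    · exact (convex_convexHull ℝ _).linear_preimage _
  exact h1 hx

lemma isFace {μ : V} (hμ : μ ∈ S.chamber) (I : Set (Fin m)) :
    IsFaceOf (S.orbitHull μ) (S.face μ I) := by
  classical
  refine ⟨convex_convexHull ℝ _, ?_, ?_⟩
  · apply convexHull_mono
    exact Set.image_mono (S.WI_le I)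
  obtain ⟨f, hf⟩ := S.exists_functional (fun i => if i ∈ I then 0 else 1)
  have hF : ∀ x ∈ S.face μ I, f x = f μ := by
    intro x hx
    obtain ⟨c, hc, hcI, rfl⟩ := S.mem_face_pt hμ hx
    rw [pt, map_sub, S.functional_sum hf, sub_eq_self]
    apply Finset.sum_eq_zero
    intro i _
    by_cases hi : i ∈ I
    · simp [hi]
    · simp [hcI i hi]
  have hH : S.orbitHull μ ⊆ {x | f x ≤ f μ ∧ (f x = f μ → x ∈ S.face μ I)} := by
    apply convexHull_min
    · rintro _ ⟨w, hw, rfl⟩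
      obtain ⟨c, hc, he⟩ := S.sub_pos hμ _ w hw rfl
      have e : f μ - f (w μ) = ∑ i, c i * (if i ∈ I then 0 else 1) := by
        rw [← map_sub, he, S.functional_sum hf]
      have hnn : ∀ i ∈ Finset.univ, 0 ≤ c i * (if i ∈ I then (0 : ℝ) else 1) := fun i _ =>
        mul_nonneg (hc i) (by split_ifs <;> norm_num)
      constructor
      · have := Finset.sum_nonneg hnn
        show f (w μ) ≤ f μ
        linarith
      · intro heq
        have heq' : f (w μ) = f μ := heq
        rw [heq', sub_self, eq_comm, Finset.sum_eq_zero_iff_of_nonneg hnn] at e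
        apply subset_convexHull
        apply S.orbit_mem_of_span hμ _ w hw rfl
        rw [he]
        apply Submodule.sum_mem
        intro i hi
        by_cases hiI : i ∈ I
        · exact Submodule.smul_mem _ _ (S.root_mem_span hiI)
        · have := e i hi
          simp only [hiI, if_false, mul_one] at this
          rw [this, zero_smul]; exact Submodule.zero_mem _
    · rw [convex_iff_forall_pos]
      rintro x ⟨hx, hx'⟩ y ⟨hy, hy'⟩ a b ha hb hab
      have e : f (a • x + b • y) = a * f x + b * f y := by simp
      have eμ : f μ = a * f μ + b * f μ := by rw [← add_mul, hab, one_mul]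
      have h1 := mul_le_mul_of_nonneg_left hx ha.le
      have h2 := mul_le_mul_of_nonneg_left hy hb.le
      refine ⟨by rw [e]; linarith, fun heq => ?_⟩
      rw [e] at heq
      have h3 : a * f x = a * f μ := by linarith
      have h4 : b * f y = b * f μ := by linarith
      exact convex_convexHull ℝ _ (hx' (mul_left_cancel₀ ha.ne' h3))
        (hy' (mul_left_cancel₀ hb.ne' h4)) ha.le hb.le hab
  rintro x hx y hy z hz ⟨a, b, ha, hb, hab, rfl⟩
  have hz' := hF _ hz
  obtain ⟨hx1, hx2⟩ := hH hx
  obtain ⟨hy1, hy2⟩ := hH hy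
  apply hx2
  have e : f (a • x + b • y) = a * f x + b * f y := by simp
  have eμ : f μ = a * f μ + b * f μ := by rw [← add_mul, hab, one_mul]
  have h1 := mul_le_mul_of_nonneg_left hx1 ha.le
  have h2 := mul_le_mul_of_nonneg_left hy1 hb.le
  rw [e] at hz'
  have h3 : a * f x = a * f μ := by linarith
  exact mul_left_cancel₀ ha.ne' h3

lemma vectorSpan_face {μ : V} (hμ : μ ∈ S.chamber) {I : Set (Fin m)} (hcon : S.MuConnected μ I) :
    vectorSpan ℝ (S.face μ I) = Submodule.span ℝ (S.root '' I) := by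
  apply le_antisymm
  · rw [vectorSpan_def, Submodule.span_le]
    have h : ∀ x ∈ S.face μ I, μ - x ∈ Submodule.span ℝ (S.root '' I) := by
      intro x hx
      obtain ⟨c, hc, hcI, rfl⟩ := S.mem_face_pt hμ hx
      rw [pt, sub_sub_cancel]
      apply Submodule.sum_mem
      intro i hi
      by_cases hiI : i ∈ I
      · exact Submodule.smul_mem _ _ (S.root_mem_span hiI)
      · rw [hcI i hiI, zero_smul]; exact Submodule.zero_mem _
    rintro _ ⟨x, hx, y, hy, rfl⟩
    have := Submodule.sub_mem _ (h y hy) (h x hx)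
    rw [sub_sub_sub_cancel_left] at this
    exact this
  · have hstab : ∀ i ∈ I, ∀ x ∈ vectorSpan ℝ (S.face μ I), S.s i x ∈ vectorSpan ℝ (S.face μ I) := by
      intro i hi
      have : vectorSpan ℝ (S.face μ I) ≤
          (vectorSpan ℝ (S.face μ I)).comap (S.s i).toLinearMap := by
        conv_lhs => rw [vectorSpan_def]
        rw [Submodule.span_le]
        rintro _ ⟨x, hx, y, hy, rfl⟩
        show S.s i (x - y) ∈ vectorSpan ℝ (S.face μ I)
        rw [map_sub]
        exact vsub_mem_vectorSpan ℝ (S.s_mem_face hi hx) (S.s_mem_face hi hy)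
      exact fun x hx => this hx
    have key : ∀ i j : I, (S.diagram.induce I).Reachable i j → S.coroot (j : Fin m) μ ≠ 0 →
        S.root i ∈ vectorSpan ℝ (S.face μ I) := by
      rintro i j ⟨p⟩ hj
      induction p with
      | nil =>
        rename_i u
        have h := vsub_mem_vectorSpan ℝ (S.mu_mem_face μ I)
          (S.s_mem_face u.2 (S.mu_mem_face μ I))
        rw [vsub_eq_sub, s_apply, sub_sub_cancel] at h
        exact (Submodule.smul_mem_iff _ hj).1 h
      | cons hadj p ih =>
        rename_i u v w
        have h1 := ih hj
        have h2 := Submodule.sub_mem _ h1 (hstab u u.2 _ h1)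
        rw [s_root, sub_sub_cancel] at h2
        have h3 : S.Adjacent u v := hadj
        exact (Submodule.smul_mem_iff _ (by exact_mod_cast h3.2.1)).1 h2
    rw [Submodule.span_le]
    rintro _ ⟨i, hi, rfl⟩
    obtain ⟨j, hj, hr⟩ := hcon ⟨i, hi⟩
    exact key _ j hr hj

lemma coroot_pt (μ : V) (c : Fin m → ℝ) (i : Fin m) :
    S.coroot i (S.pt μ c) = S.coroot i μ - ∑ j, c j * S.A i j := by
  simp [pt, map_sum, S.pairing]

lemma coroot_pt_ge {μ : V} {c : Fin m → ℝ} (hc : ∀ i, 0 ≤ c i) {i : Fin m} (hi : c i = 0)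
    (j : Fin m) : S.coroot i μ - c j * S.A i j ≤ S.coroot i (S.pt μ c) := by
  rw [coroot_pt]
  have hterm : ∀ k, c k * S.A i k ≤ 0 := by
    intro k
    by_cases hk : i = k
    · subst hk; rw [hi, zero_mul]
    · exact mul_nonpos_of_nonneg_of_nonpos (hc k) (by exact_mod_cast S.A_offdiag i k hk)
  have : ∑ k, c k * (S.A i k : ℝ) ≤ c j * S.A i j := by
    rw [← Finset.add_sum_erase _ _ (Finset.mem_univ j)]
    have := Finset.sum_nonpos (s := Finset.univ.erase j) (fun k _ => hterm k)
    linarith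
  linarith

/-- admissible coefficient vectors -/
structure Good (μ : V) (I : Set (Fin m)) (c : Fin m → ℝ) : Prop where
  nn : ∀ i, 0 ≤ c i
  supp : ∀ i, i ∉ I → c i = 0
  mem : S.pt μ c ∈ S.face μ I
  dom : ∀ i, 0 ≤ S.coroot i (S.pt μ c)
  str : ∀ i, 0 < c i → 0 < S.coroot i (S.pt μ c)

lemma good_zero {μ : V} (hμ : μ ∈ S.chamber) (I : Set (Fin m)) : S.Good μ I 0 := by
  have : S.pt μ 0 = μ := by simp [pt]
  refine ⟨fun _ => le_rfl, fun _ _ => rfl, ?_, ?_, ?_⟩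
  · rw [this]; exact S.mu_mem_face μ I
  · rw [this]; exact hμ
  · intro i hi; exact absurd hi (lt_irrefl _)

lemma good_step {μ : V} {I : Set (Fin m)} {c : Fin m → ℝ} (h : S.Good μ I c) {i : Fin m}
    (hi : i ∈ I) (hp : 0 < S.coroot i (S.pt μ c)) :
    ∃ c', S.Good μ I c' ∧ (∀ j, c j ≤ c' j) ∧ 0 < c' i := by
  obtain ⟨t, ht⟩ : ∃ t, t = S.coroot i (S.pt μ c) := ⟨_, rfl⟩
  rw [← ht] at hp
  have hpt : S.pt μ (fun j => c j + if j = i then t / 4 else 0) =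
      S.pt μ c - (t / 4) • S.root i := by
    simp [pt, add_smul, Finset.sum_add_distrib, ite_smul, sub_sub]
  have hle : ∀ j, c j ≤ (fun j => c j + if j = i then t / 4 else 0) j := by
    intro j
    dsimp only
    split_ifs <;> linarith
  have hco : ∀ j, S.coroot j (S.pt μ (fun j => c j + if j = i then t / 4 else 0)) =
      S.coroot j (S.pt μ c) - t / 4 * S.A j i := by
    intro j
    rw [hpt, map_sub, map_smul, S.pairing, smul_eq_mul]
  have hii : S.coroot i (S.pt μ (fun j => c j + if j = i then t / 4 else 0)) = t / 2 := by
    rw [hco, S.A_diag, ← ht]; push_cast; ring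
  have hij : ∀ j, j ≠ i → S.coroot j (S.pt μ c) ≤
      S.coroot j (S.pt μ (fun j => c j + if j = i then t / 4 else 0)) := by
    intro j hj
    rw [hco]
    have : (S.A j i : ℝ) ≤ 0 := by exact_mod_cast S.A_offdiag j i hj
    nlinarith
  refine ⟨fun j => c j + if j = i then t / 4 else 0, ⟨fun j => (h.nn j).trans (hle j), ?_, ?_, ?_, ?_⟩, hle, ?_⟩
  · intro j hj
    have : j ≠ i := fun e => hj (e ▸ hi)
    simp [this, h.supp j hj]
  · have e : S.pt μ (fun j => c j + if j = i then t / 4 else 0) =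
        (3 / 4 : ℝ) • S.pt μ c + (1 / 4 : ℝ) • S.s i (S.pt μ c) := by
      rw [hpt, s_apply, ← ht]
      module
    rw [e]
    exact convex_convexHull ℝ _ h.mem (S.s_mem_face hi h.mem) (by norm_num) (by norm_num)
      (by norm_num)
  · intro j
    by_cases hj : j = i
    · subst hj; rw [hii]; linarith
    · exact (h.dom j).trans (hij j hj)
  · intro j hj0
    by_cases hj : j = i
    · subst hj; rw [hii]; linarith
    · simp only [hj, if_false, add_zero] at hj0
      exact (h.str j hj0).trans_le (hij j hj)
  · have := h.nn i
    simp only [if_true]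
    linarith

lemma good_extend {μ : V} (hμ : μ ∈ S.chamber) {I : Set (Fin m)} (i j : I)
    (hr : (S.diagram.induce I).Reachable i j) (hj : S.coroot (j : Fin m) μ ≠ 0)
    {c : Fin m → ℝ} (h : S.Good μ I c) :
    ∃ c', S.Good μ I c' ∧ (∀ j, c j ≤ c' j) ∧ 0 < c' i := by
  obtain ⟨p⟩ := hr
  induction p with
  | nil =>
    rename_i u
    rcases (h.nn u).lt_or_eq with h0 | h0
    · exact ⟨c, h, fun _ => le_rfl, h0⟩
    · apply S.good_step h u.2
      have := S.coroot_pt_ge (μ := μ) h.nn h0.symm u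
      rw [← h0, zero_mul, sub_zero] at this
      exact (lt_of_le_of_ne (hμ _) (Ne.symm hj)).trans_le this
  | cons hadj p ih =>
    rename_i u v w
    obtain ⟨c', hc', hle, hpos⟩ := ih hj
    rcases (hc'.nn u).lt_or_eq with h0 | h0
    · exact ⟨c', hc', hle, h0⟩
    · have h3 : S.Adjacent u v := hadj
      have h4 : (S.A u v : ℝ) < 0 := by
        exact_mod_cast lt_of_le_of_ne (S.A_offdiag u v h3.1) h3.2.1
      have := S.coroot_pt_ge (μ := μ) hc'.nn h0.symm v
      have h5 := hμ u
      have h6 := mul_neg_of_pos_of_neg hpos h4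
      obtain ⟨c'', g, hle', hpos'⟩ := S.good_step hc' u.2 (by linarith)
      exact ⟨c'', g, fun k => (hle k).trans (hle' k), hpos'⟩

lemma good_full {μ : V} (hμ : μ ∈ S.chamber) {I : Set (Fin m)} (hcon : S.MuConnected μ I) :
    ∃ c, S.Good μ I c ∧ ∀ i ∈ I, 0 < c i := by
  classical
  have : ∀ K : Finset (Fin m), ∃ c, S.Good μ I c ∧ ∀ i ∈ K, i ∈ I → 0 < c i := by
    intro K
    induction K using Finset.induction_on with
    | empty => exact ⟨0, S.good_zero hμ I, by simp⟩
    | insert a K ha ih =>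
      obtain ⟨c, hc, hK⟩ := ih
      by_cases haI : a ∈ I
      · obtain ⟨j, hj, hr⟩ := hcon ⟨a, haI⟩
        obtain ⟨c', hc', hle, hpos⟩ := S.good_extend hμ _ _ hr hj hc
        refine ⟨c', hc', fun i hi hiI => ?_⟩
        rcases Finset.mem_insert.1 hi with rfl | hi
        · exact hpos
        · exact (hK i hi hiI).trans_le (hle i)
      · refine ⟨c, hc, fun i hi hiI => ?_⟩
        rcases Finset.mem_insert.1 hi with rfl | hi
        · exact absurd hiI haI
        · exact hK i hi hiI
  obtain ⟨c, hc, h⟩ := this Finset.univ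
  exact ⟨c, hc, fun i hi => h i (Finset.mem_univ _) hi⟩

lemma combo_intrinsicInterior {F : Set V} (hF : Convex ℝ F) {z x : V} (hz : z ∈ F)
    (hx : x ∈ intrinsicInterior ℝ F) {ε : ℝ} (h0 : 0 < ε) (h1 : ε ≤ 1) :
    (1 - ε) • z + ε • x ∈ intrinsicInterior ℝ F := by
  rw [mem_intrinsicInterior] at hx ⊢
  obtain ⟨y, hy, rfl⟩ := hx
  haveI : Nonempty (affineSpan ℝ F) := ⟨y⟩
  let z' : affineSpan ℝ F := ⟨z, subset_affineSpan ℝ F hz⟩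
  have hcoe : ∀ u : affineSpan ℝ F, ((AffineMap.homothety z' ε u : affineSpan ℝ F) : V) =
      (1 - ε) • z + ε • (u : V) := by
    intro u
    rw [AffineMap.homothety_apply]
    show ε • ((u : V) - z) + z = _
    module
  refine ⟨AffineMap.homothety z' ε y, ?_, hcoe y⟩
  have hopen := AffineMap.homothety_isOpenMap z' ε h0.ne'
  refine interior_mono ?_ (hopen.image_interior_subset _ ⟨y, hy, rfl⟩)
  rintro _ ⟨u, hu, rfl⟩
  show ((AffineMap.homothety z' ε u : affineSpan ℝ F) : V) ∈ F
  rw [hcoe]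
  exact hF hz hu (by linarith) h0.le (by ring)

lemma exists_point {μ : V} (hμ : μ ∈ S.chamber) {I : Set (Fin m)} (hcon : S.MuConnected μ I) :
    (intrinsicInterior ℝ (S.face μ I) ∩ ((fun v => μ - v) '' S.conePos I) ∩
      S.openFacet (S.starSet μ I)).Nonempty := by
  haveI := S.finDim
  obtain ⟨c, hc, hcI⟩ := S.good_full hμ hcon
  obtain ⟨x, hx⟩ := Set.Nonempty.intrinsicInterior (convex_convexHull ℝ (orbitOf (S.WI I) μ))
    ⟨μ, S.mu_mem_face μ I⟩
  have hx' : x ∈ intrinsicInterior ℝ (S.face μ I) := hx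
  obtain ⟨d, hd, hdI, rfl⟩ := S.mem_face_pt hμ (intrinsicInterior_subset hx')
  have hpos : ∀ i, i ∉ S.starSet μ I → 0 < S.coroot i (S.pt μ c) := by
    intro i hi
    by_cases hiI : i ∈ I
    · exact hc.str i (hcI i hiI)
    · have hc0 := hc.supp i hiI
      by_cases h0 : S.coroot i μ = 0
      · obtain ⟨j, hj, hne⟩ : ∃ j ∈ I, S.coroot i (S.root j) ≠ 0 := by
          by_contra hcon'
          push Not at hcon'
          exact hi ⟨h0, hiI, hcon'⟩
        rw [S.pairing] at hne
        have hij : i ≠ j := fun e => hiI (e ▸ hj)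
        have h4 : (S.A i j : ℝ) < 0 :=
          lt_of_le_of_ne (by exact_mod_cast S.A_offdiag i j hij) hne
        have := S.coroot_pt_ge (μ := μ) hc.nn hc0 j
        have h6 := mul_neg_of_pos_of_neg (hcI j hj) h4
        linarith
      · have := S.coroot_pt_ge (μ := μ) hc.nn hc0 i
        rw [hc0, zero_mul, sub_zero] at this
        exact (lt_of_le_of_ne (hμ i) (Ne.symm h0)).trans_le this
  have hev : ∀ᶠ ε : ℝ in nhdsWithin 0 (Set.Ioi 0), ∀ i, i ∉ S.starSet μ I →
      0 < (1 - ε) * S.coroot i (S.pt μ c) + ε * S.coroot i (S.pt μ d) := by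
    rw [Filter.eventually_all]
    intro i
    by_cases hi : i ∈ S.starSet μ I
    · exact Filter.Eventually.of_forall fun _ h => absurd hi h
    · have hcont : ContinuousAt (fun ε : ℝ => (1 - ε) * S.coroot i (S.pt μ c) +
          ε * S.coroot i (S.pt μ d)) 0 := by fun_prop
      have := hcont.eventually (lt_mem_nhds (a := 0) (by simpa using hpos i hi))
      exact (this.filter_mono nhdsWithin_le_nhds).mono fun ε h _ => h
  have hev2 : ∀ᶠ ε : ℝ in nhdsWithin 0 (Set.Ioi 0), ε ∈ Set.Ioo (0 : ℝ) 1 :=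
    Ioo_mem_nhdsGT one_pos
  obtain ⟨ε, hε, hε0, hε1⟩ := (hev.and hev2).exists
  refine ⟨(1 - ε) • S.pt μ c + ε • S.pt μ d, ⟨?_, ?_⟩, ?_, ?_⟩
  · exact combo_intrinsicInterior (convex_convexHull ℝ _) hc.mem hx' hε0 hε1.le
  · rw [S.pt_combo μ c d (by ring)]
    refine ⟨_, ⟨_, ?_, ?_, rfl⟩, rfl⟩
    · intro i hi
      have h1 := mul_pos (_root_.sub_pos.2 hε1) (hcI i hi)
      have h2 := mul_nonneg hε0.le (hd i)
      show 0 < (1 - ε) * c i + ε * d i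
      linarith
    · intro i hi
      simp [hc.supp i hi, hdI i hi]
  · rintro i ⟨h0, hiI, horth⟩
    have hz : ∀ e : Fin m → ℝ, (∀ i, i ∉ I → e i = 0) → S.coroot i (S.pt μ e) = 0 := by
      intro e he
      rw [pt, map_sub, h0, zero_sub, neg_eq_zero, map_sum]
      apply Finset.sum_eq_zero
      intro j _
      by_cases hj : j ∈ I
      · rw [map_smul, horth j hj, smul_zero]
      · rw [he j hj, zero_smul, map_zero]
    rw [map_add, map_smul, map_smul, hz c hc.supp, hz d hdI]
    simp
  · intro i hi
    rw [map_add, map_smul, map_smul]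
    exact hε i hi

end GCMRealization

open GCMRealization in
theorem statement_5 {m : ℕ} {V : Type*} [NormedAddCommGroup V] [NormedSpace ℝ V]
    (S : GCMRealization m V) (μ : V) (hμ : μ ∈ S.chamber)
    (I : Set (Fin m)) (hcon : S.MuConnected μ I) :
    (intrinsicInterior ℝ (S.face μ I) ∩ ((fun v => μ - v) '' S.conePos I) ∩
      S.openFacet (S.starSet μ I)).Nonempty ∧
    S.IsFundFace μ (S.face μ I) ∧
    (affineSpan ℝ (S.face μ I) : Set V) =
      (fun v => μ + v) '' (Submodule.span ℝ (S.root '' I) : Set V) ∧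
    finrank ℝ (vectorSpan ℝ (S.face μ I)) = I.ncard := by

  have hvs := S.vectorSpan_face hμ hcon
  have hpt := S.exists_point hμ hcon
  refine ⟨hpt, ⟨S.isFace hμ I, Or.inr ?_⟩, ?_, ?_⟩
  · obtain ⟨x, ⟨hx1, -⟩, hx2, hx3⟩ := hpt
    refine ⟨x, hx1, fun i => ?_⟩
    by_cases hi : i ∈ S.starSet μ I
    · exact (hx2 i hi).ge
    · exact (hx3 i hi).le
  · have hm : μ ∈ affineSpan ℝ (S.face μ I) := subset_affineSpan ℝ _ (S.mu_mem_face μ I)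
    ext x
    rw [SetLike.mem_coe, ← AffineSubspace.vsub_right_mem_direction_iff_mem hm,
      direction_affineSpan, hvs, vsub_eq_sub]
    constructor
    · intro h
      exact ⟨x - μ, h, by simp⟩
    · rintro ⟨v, hv, rfl⟩
      simpa using hv
  · rw [hvs]
    classical
    have hli : LinearIndependent ℝ (fun i : I => S.root i) :=
      S.root_indep.comp _ Subtype.val_injective
    have h := finrank_span_eq_card hli
    have hr : Set.range (fun i : I => S.root i) = S.root '' I := by
      ext x; simp
    rw [hr] at h
    rw [h, Set.ncard_eq_toFinset_card', Set.toFinset_card]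
end
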